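/- Let w be a permutation of {1,…,n} and let h ∈ SL(n,ℝ) satisfy h·ẇ⁻¹ ∈ N₋ and ẇ⁻¹·h ∈ N. Then every right-aligned flag minor of h is nonnegative if and only if every top-aligned flag minor of (hᵀ)⁻¹ is nonnegative. -/

import Mathlib

open Matrix Finset

namespace Paper

open scoped Classical

noncomputable section

variable {K : Type*} [Field K] {n m : ℕ}

/-- `N`: upper unitriangular matrices. -/
def IsN (g : Matrix (Fin n) (Fin n) K) : Prop :=
  (∀ i, g i i = 1) ∧ ∀ i j : Fin n, j < i → g i j = 0

/-- `N₋`: lower unitriangular matrices. -/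
def IsNm (g : Matrix (Fin n) (Fin n) K) : Prop :=
  (∀ i, g i i = 1) ∧ ∀ i j : Fin n, i < j → g i j = 0

/-- `B`: upper triangular matrices of determinant 1. -/
def IsB (g : Matrix (Fin n) (Fin n) K) : Prop :=
  g.det = 1 ∧ ∀ i j : Fin n, j < i → g i j = 0

/-- `B₋`: lower triangular matrices of determinant 1. -/
def IsBm (g : Matrix (Fin n) (Fin n) K) : Prop :=
  g.det = 1 ∧ ∀ i j : Fin n, i < j → g i j = 0

/-- `H`: diagonal matrices of determinant 1. -/
def IsH (g : Matrix (Fin n) (Fin n) K) : Prop :=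
  g.det = 1 ∧ ∀ i j : Fin n, i ≠ j → g i j = 0

/-- UDL factorization: `g = yp * y0 * ym` with `yp ∈ N`, `y0 ∈ H`, `ym ∈ N₋`. -/
def UDL (g yp y0 ym : Matrix (Fin n) (Fin n) K) : Prop :=
  IsN yp ∧ IsH y0 ∧ IsNm ym ∧ g = yp * y0 * ym

/-- LDU factorization: `g = zm * z0 * zp` with `zm ∈ N₋`, `z0 ∈ H`, `zp ∈ N`. -/
def LDU (g zm z0 zp : Matrix (Fin n) (Fin n) K) : Prop :=
  IsNm zm ∧ IsH z0 ∧ IsN zp ∧ g = zm * z0 * zp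

/-- The signed permutation matrix `v̇`. -/
def pdot (v : Equiv.Perm (Fin n)) : Matrix (Fin n) (Fin n) K :=
  Matrix.of fun a b : Fin n =>
    if a = v b then
      (-1 : K) ^ (univ.filter fun k : Fin n => b < k ∧ v k < v b).card
    else 0

/-- Membership in the double coset `B₋ w B₋`. -/
def InBmWBm (w : Equiv.Perm (Fin n)) (g : Matrix (Fin n) (Fin n) K) : Prop :=
  ∃ b₁ b₂ : Matrix (Fin n) (Fin n) K, IsBm b₁ ∧ IsBm b₂ ∧ g = b₁ * pdot w * b₂

/-- `Δ^I_J(g)`: the minor with row set `I` and column set `J` (junk value 0 if sizes differ). -/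
def minor (g : Matrix (Fin n) (Fin n) K) (I J : Finset (Fin n)) : K :=
  if h : I.card = J.card then
    Matrix.det (Matrix.of fun a b : Fin I.card =>
      g (I.orderEmbOfFin rfl a) (J.orderEmbOfFin h.symm b))
  else 0

/-- All right-aligned flag minors of `g` are nonnegative. -/
def RightFlagNonneg (g : Matrix (Fin n) (Fin n) ℝ) : Prop :=
  ∀ I : Finset (Fin n),
    0 ≤ minor g I (univ.filter fun j : Fin n => n - I.card ≤ (j : ℕ))

/-- All top-aligned flag minors of `g` are nonnegative. -/
def TopFlagNonneg (g : Matrix (Fin n) (Fin n) ℝ) : Prop :=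
  ∀ J : Finset (Fin n),
    0 ≤ minor g (univ.filter fun i : Fin n => (i : ℕ) < J.card) J

/-- `x_i(t)` (with 1-based `i`): `Id + t·E_{i,i+1}`. -/
def xmat (i : ℕ) (t : K) : Matrix (Fin n) (Fin n) K :=
  Matrix.of fun a b : Fin n =>
    if a = b then 1 else if (a : ℕ) + 1 = i ∧ (b : ℕ) = i then t else 0

/-- `y_i(t)` (with 1-based `i`): `Id + t·E_{i+1,i}`. -/
def ymat (i : ℕ) (t : K) : Matrix (Fin n) (Fin n) K :=
  Matrix.of fun a b : Fin n =>
    if a = b then 1 else if (a : ℕ) = i ∧ (b : ℕ) + 1 = i then t else 0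

/-- `ṡ_i` (with 1-based `i`). -/
def sdot (i : ℕ) : Matrix (Fin n) (Fin n) K :=
  Matrix.of fun a b : Fin n =>
    if (a : ℕ) + 1 = i ∧ (b : ℕ) = i then 1
    else if (a : ℕ) = i ∧ (b : ℕ) + 1 = i then -1
    else if a = b ∧ (a : ℕ) + 1 ≠ i ∧ (a : ℕ) ≠ i then 1
    else 0

/-- The adjacent transposition `s_i` (with 1-based `i`); identity if out of range. -/
def sperm (n : ℕ) (i : ℕ) : Equiv.Perm (Fin n) :=
  if h : i < n then
    Equiv.swap ⟨i - 1, Nat.lt_of_le_of_lt (Nat.sub_le i 1) h⟩ ⟨i, h⟩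
  else 1

/-- `ℓ(w)`: the number of inversions of `w`. -/
def len (w : Equiv.Perm (Fin n)) : ℕ :=
  (univ.filter fun p : Fin n × Fin n => p.1 < p.2 ∧ w p.2 < w p.1).card

/-- `vseq ii v k = v_{(m-k)}`: the rightmost (positive distinguished) subexpression recursion. -/
def vseq (ii : Fin m → ℕ) (v : Equiv.Perm (Fin n)) : ℕ → Equiv.Perm (Fin n)
  | 0 => v
  | k + 1 =>
    if h : m - k - 1 < m then
      if len (vseq ii v k * sperm n (ii ⟨m - k - 1, h⟩)) < len (vseq ii v k) then
        vseq ii v k * sperm n (ii ⟨m - k - 1, h⟩)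
      else vseq ii v k
    else vseq ii v k

/-- `r ∈ J°` (0-based `r`, corresponding to the 1-based index `r+1`). -/
def inJ (ii : Fin m → ℕ) (v : Equiv.Perm (Fin n)) (r : Fin m) : Prop :=
  vseq ii v (m - (r : ℕ)) = vseq ii v (m - (r : ℕ) - 1)

/-- The list `[s_{i_1}, …, s_{i_m}]` of adjacent transpositions. -/
def sPermList (n : ℕ) (ii : Fin m → ℕ) : List (Equiv.Perm (Fin n)) :=
  List.ofFn fun r => sperm n (ii r)

/-- The list `[s^v_{i_1}, …, s^v_{i_m}]`. -/
def svPermList (ii : Fin m → ℕ) (v : Equiv.Perm (Fin n)) : List (Equiv.Perm (Fin n)) :=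
  List.ofFn fun r => if inJ ii v r then 1 else sperm n (ii r)

/-- The factors `g_1, …, g_m` of the Marsh–Rietsch element. -/
def mrgList (ii : Fin m → ℕ) (v : Equiv.Perm (Fin n)) (t : Fin m → K) :
    List (Matrix (Fin n) (Fin n) K) :=
  List.ofFn fun r => if inJ ii v r then xmat (ii r) (t r) else sdot (ii r)

/-- The Marsh–Rietsch element `g = g_1 ⋯ g_m`. -/
def mrg (ii : Fin m → ℕ) (v : Equiv.Perm (Fin n)) (t : Fin m → K) :
    Matrix (Fin n) (Fin n) K :=
  (mrgList ii v t).prod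

/-- The list `[ṡ_{i_1}, …, ṡ_{i_m}]`. -/
def sdotList (n : ℕ) (ii : Fin m → ℕ) : List (Matrix (Fin n) (Fin n) K) :=
  List.ofFn fun r => sdot (ii r)

/-- `ẇ = ṡ_{i_1} ⋯ ṡ_{i_m}`. -/
def wMR (n : ℕ) (ii : Fin m → ℕ) : Matrix (Fin n) (Fin n) K :=
  (sdotList n ii).prod



theorem aux_plucker {s : ℕ} (P : Matrix (Fin s) (Fin s) ℝ) (p q : Fin s) (hpq : p ≠ q)
    (z e : Fin s → ℝ) :
    det P * det ((P.updateRow q e).updateRow p z) =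
      det (P.updateRow p z) * det (P.updateRow q e) +
      det (P.updateRow q z) * det ((P.updateRow q e).updateRow p (P.row q)) := by
  have h1 := mulVec_cramer Pᵀ z
  have h2 : ∑ i, (P.updateRow i z).det • P.row i = P.det • z := by
    rw [det_transpose] at h1
    rw [← h1]
    ext j
    simp only [Finset.sum_apply, Pi.smul_apply, smul_eq_mul, mulVec, dotProduct,
      cramer_transpose_apply, transpose_apply, Matrix.row]
    exact Finset.sum_congr rfl fun i _ => mul_comm _ _
  have h3 := congrArg (fun v => cramer (P.updateRow q e)ᵀ v p) h2
  have h4 : (cramer (P.updateRow q e)ᵀ (P.det • z)) p =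
      P.det * det ((P.updateRow q e).updateRow p z) := by
    rw [map_smul, Pi.smul_apply, smul_eq_mul, cramer_transpose_apply]
  have h5 : (cramer (P.updateRow q e)ᵀ (∑ i, (P.updateRow i z).det • P.row i)) p =
      ∑ i, (P.updateRow i z).det * det ((P.updateRow q e).updateRow p (P.row i)) := by
    rw [map_sum, Finset.sum_apply]
    refine Finset.sum_congr rfl fun i _ => ?_
    rw [map_smul, Pi.smul_apply, smul_eq_mul, cramer_transpose_apply]
  rw [← h4, ← h3, h5]
  rw [Finset.sum_eq_add_of_mem p q (Finset.mem_univ _) (Finset.mem_univ _) hpq]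
  · congr 2
    congr 1
    ext i j
    by_cases hi : i = p
    · subst hi; simp [Matrix.updateRow_apply, hpq, Matrix.row]
    · simp [Matrix.updateRow_apply, hi]
  · rintro c - ⟨hcp, hcq⟩
    have : det ((P.updateRow q e).updateRow p (P.row c)) = 0 := by
      apply det_zero_of_row_eq (i := p) (j := c) (Ne.symm hcp)
      ext j
      simp [Matrix.updateRow_apply, hcp, hcq, Matrix.row]
    rw [this, mul_zero]

theorem aux_sign {s : ℕ} (p q : Fin (s + 1)) : ∃ ε : ℝ, ε ≠ 0 ∧
    ∀ (x : Fin (s + 1) → ℝ) (β : Fin s → Fin (s + 1) → ℝ),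
      det (Matrix.of (p.insertNth x β : Fin (s + 1) → Fin (s + 1) → ℝ)) =
        ε * det (Matrix.of (q.insertNth x β : Fin (s + 1) → Fin (s + 1) → ℝ)) := by
  let σ : Equiv.Perm (Fin (s + 1)) := (finSuccEquiv' p).trans (finSuccEquiv' q).symm
  refine ⟨((Equiv.Perm.sign σ : ℤ) : ℝ), ?_, fun x β => ?_⟩
  · rcases Int.units_eq_one_or (Equiv.Perm.sign σ) with h | h <;> simp [h]
  · rw [← det_permute]
    congr 1
    ext i j
    refine Fin.succAboveCases p ?_ (fun i => ?_) i
    · simp [σ]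
    · simp [σ]

/-- three-term relation. -/
theorem aux_three {s : ℕ} (α : Fin s → Fin (s + 2) → ℝ) (b c l e : Fin (s + 2) → ℝ) :
    let E : (Fin (s + 2) → ℝ) → (Fin (s + 2) → ℝ) → ℝ := fun x y =>
      det (Matrix.of (Fin.snoc (Fin.snoc α x : Fin (s + 1) → Fin (s + 2) → ℝ) y :
        Fin (s + 2) → Fin (s + 2) → ℝ))
    E b l * E c e = E c l * E b e + E b c * E l e := by
  intro E
  have := aux_plucker (Matrix.of (Fin.snoc (Fin.snoc α b : Fin (s + 1) → Fin (s + 2) → ℝ) l :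
        Fin (s + 2) → Fin (s + 2) → ℝ)) (Fin.last s).castSucc (Fin.last (s + 1))
        (by simp [Fin.ext_iff]) c e
  have hq : ∀ x y z : Fin (s + 2) → ℝ, (Matrix.of (Fin.snoc (Fin.snoc α x :
      Fin (s + 1) → Fin (s + 2) → ℝ) y : Fin (s + 2) → Fin (s + 2) → ℝ)).updateRow
        (Fin.last (s + 1)) z = Matrix.of (Fin.snoc (Fin.snoc α x :
      Fin (s + 1) → Fin (s + 2) → ℝ) z : Fin (s + 2) → Fin (s + 2) → ℝ) := by
    intro x y z
    ext i j
    refine Fin.lastCases ?_ (fun i => ?_) i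
    · simp [Matrix.updateRow_apply]
    · simp [Matrix.updateRow_apply, Fin.ext_iff, i.2.ne]
  have hp : ∀ x y z : Fin (s + 2) → ℝ, (Matrix.of (Fin.snoc (Fin.snoc α x :
      Fin (s + 1) → Fin (s + 2) → ℝ) y : Fin (s + 2) → Fin (s + 2) → ℝ)).updateRow
        (Fin.last s).castSucc z = Matrix.of (Fin.snoc (Fin.snoc α z :
      Fin (s + 1) → Fin (s + 2) → ℝ) y : Fin (s + 2) → Fin (s + 2) → ℝ) := by
    intro x y z
    ext i j
    refine Fin.lastCases ?_ (fun i => ?_) i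
    · simp [Matrix.updateRow_apply, Fin.ext_iff]
    · refine Fin.lastCases ?_ (fun i => ?_) i
      · simp [Matrix.updateRow_apply]
      · simp [Matrix.updateRow_apply, Fin.ext_iff, i.2.ne]
  have hr : (Matrix.of (Fin.snoc (Fin.snoc α b : Fin (s + 1) → Fin (s + 2) → ℝ) l :
        Fin (s + 2) → Fin (s + 2) → ℝ)).row (Fin.last (s + 1)) = l := by
    ext j; simp [Matrix.row]
  rw [hr] at this
  simp only [hp, hq] at this
  simpa [E] using this

/-- nonzero determinants admit a nonzero transversal. -/
theorem aux_transversal {k : ℕ} (M : Matrix (Fin k) (Fin k) ℝ) (h : det M ≠ 0) :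
    ∃ σ : Equiv.Perm (Fin k), ∀ i, M (σ i) i ≠ 0 := by
  by_contra hcon
  push Not at hcon
  apply h
  rw [det_apply]
  refine Finset.sum_eq_zero fun σ _ => ?_
  obtain ⟨i, hi⟩ := hcon σ
  have : ∏ i, M (σ i) i = 0 := Finset.prod_eq_zero (Finset.mem_univ i) hi
  rw [this, smul_zero]

/-- the truncation: appending the last basis vector. -/
theorem aux_trunc {s : ℕ} (v : Fin s → Fin (s + 1) → ℝ) :
    det (Matrix.of (Fin.snoc v (Pi.single (Fin.last s) 1) : Fin (s + 1) → Fin (s + 1) → ℝ)) =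
      det (Matrix.of fun i j : Fin s => v i j.castSucc) := by
  rw [det_succ_row _ (Fin.last s), Finset.sum_eq_single (Fin.last s)]
  · have : ((-1 : ℝ)) ^ (s + s) = 1 := by rw [← two_mul, pow_mul]; simp
    simp only [Fin.val_last, this, one_mul, of_apply, Fin.snoc_last, Pi.single_eq_same]
    congr 1
    ext i j
    simp [Fin.succAbove_last]
  · intro j _ hj
    simp [hj]
  · simp

/-- Jacobi for leading principal minors. -/
theorem aux_jacobi {n : ℕ} (h g : Matrix (Fin n) (Fin n) ℝ) (hg : g * hᵀ = 1)
    (k m : ℕ) (hn : n = m + k) :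
    det h * det (g.submatrix (Fin.castLE (by omega : m ≤ n)) (Fin.castLE (by omega : m ≤ n))) =
      det (h.submatrix (fun i : Fin k => (⟨m + i, by omega⟩ : Fin n))
        (fun i : Fin k => (⟨m + i, by omega⟩ : Fin n))) := by
  subst hn
  have hg' : h * gᵀ = 1 := by
    have := congrArg transpose hg
    simpa using this
  let H := h.submatrix finSumFinEquiv finSumFinEquiv
  let G := gᵀ.submatrix finSumFinEquiv finSumFinEquiv
  have hHG : H * G = 1 := by
    simp only [H, G]
    rw [Matrix.submatrix_mul_equiv, hg']
    simp
  rw [← fromBlocks_toBlocks H, ← fromBlocks_toBlocks G, fromBlocks_multiply,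
    ← fromBlocks_one, fromBlocks_inj] at hHG
  obtain ⟨e1, e2, e3, e4⟩ := hHG
  have key : H * fromBlocks G.toBlocks₁₁ 0 G.toBlocks₂₁ 1 =
      fromBlocks 1 H.toBlocks₁₂ 0 H.toBlocks₂₂ := by
    conv_lhs => rw [← fromBlocks_toBlocks H]
    rw [fromBlocks_multiply, e1, e3]
    simp
  have := congrArg det key
  rw [det_mul, det_fromBlocks_zero₂₁, det_fromBlocks_zero₁₂, det_one, det_one, one_mul,
    mul_one, det_submatrix_equiv_self] at this
  rw [← det_transpose (g.submatrix _ _)]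
  exact this


/-- the last `k` columns. -/
def rcol {k n : ℕ} (hk : k ≤ n) : Fin k → Fin n := fun i => ⟨n - k + i, by omega⟩

/-- matching condition for row sets. -/
def RG {n : ℕ} (w : Fin n → Fin n) {k : ℕ} (hk : k ≤ n) (f : Fin k → Fin n) : Prop :=
  ∃ σ : Fin k → Fin k, Function.Injective σ ∧ ∀ i, w (rcol hk i) ≤ f (σ i)

def cntK {m n : ℕ} (κ : Fin m → Fin n) (t : ℕ) : ℕ := ∑ i, if t ≤ (κ i : ℕ) then 1 else 0

def cntX {n : ℕ} (w : Fin n → Fin n) (m t : ℕ) : ℕ :=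
  ∑ j : Fin n, if t ≤ (j : ℕ) ∧ (w j : ℕ) < m then 1 else 0

def TG {n : ℕ} (w : Fin n → Fin n) {m : ℕ} (κ : Fin m → Fin n) : Prop :=
  ∀ t, cntK κ t ≤ cntX w m t

def sg {n : ℕ} (r : Fin (n + 1)) (a : Fin n) : ℝ := if a.castSucc < r then 1 else -1

def delM {n : ℕ} (r : Fin (n + 1)) (M : Matrix (Fin (n + 1)) (Fin (n + 1)) ℝ) :
    Matrix (Fin n) (Fin n) ℝ := Matrix.of fun a b => sg r a * M (r.succAbove a) b.castSucc

theorem aux_prod_sg {k : ℕ} (p : Fin (k + 1)) : ∏ i : Fin k, sg p i = (-1) ^ (k - (p : ℕ)) := by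
  simp only [sg]
  rw [Finset.prod_ite]
  simp only [Finset.prod_const, one_pow, one_mul]
  congr 1
  have h1 : (univ.filter fun i : Fin k => ¬ i.castSucc < p).card +
      (univ.filter fun i : Fin k => i.castSucc < p).card = k := by
    have := Finset.card_filter_add_card_filter_not (s := (univ : Finset (Fin k)))
      (fun i : Fin k => i.castSucc < p)
    simp only [Finset.card_univ, Fintype.card_fin] at this
    omega
  have h2 : (univ.filter fun i : Fin k => i.castSucc < p).card = p := by
    have : (univ.filter fun i : Fin k => i.castSucc < p) =
      (univ : Finset (Fin (p : ℕ))).map (Fin.castLEEmb (by omega)) := by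
      ext i
      simp only [mem_filter, mem_univ, true_and, mem_map, Fin.lt_def, Fin.val_castSucc]
      constructor
      · intro h; exact ⟨⟨i, h⟩, by ext; simp⟩
      · rintro ⟨a, rfl⟩; simp
    rw [this]; simp
  omega

theorem aux_insert_mono {k n : ℕ} (p : Fin (k + 1)) (r : Fin n) (v : Fin k → Fin n)
    (hv : StrictMono v) (h1 : ∀ i : Fin k, i.castSucc < p → v i < r)
    (h2 : ∀ i : Fin k, p ≤ i.castSucc → r < v i) :
    StrictMono (p.insertNth r v : Fin (k + 1) → Fin n) := by
  intro a b
  refine Fin.succAboveCases p ?_ (fun a => ?_) a <;>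
    refine Fin.succAboveCases p ?_ (fun b => ?_) b
  · simp
  · intro h
    simp only [Fin.insertNth_apply_same, Fin.insertNth_apply_succAbove]
    exact h2 _ ((Fin.lt_succAbove_iff_le_castSucc _ _).1 h)
  · intro h
    simp only [Fin.insertNth_apply_same, Fin.insertNth_apply_succAbove]
    exact h1 _ ((Fin.succAbove_lt_iff_castSucc_lt _ _).1 h)
  · intro h
    simp only [Fin.insertNth_apply_succAbove]
    exact hv ((Fin.succAbove_lt_succAbove_iff).1 h)

theorem aux_exists_p {k : ℕ} (P : Fin k → Prop) (hP : ∀ i j, i < j → P j → P i) :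
    ∃ p : Fin (k + 1), ∀ i : Fin k, i.castSucc < p ↔ P i := by
  have hex : ∃ q : ℕ, ∀ hi : q < k, ¬ P ⟨q, hi⟩ := ⟨k, fun h => absurd h (lt_irrefl _)⟩
  have hle : Nat.find hex ≤ k := Nat.find_min' hex (fun h => absurd h (lt_irrefl _))
  refine ⟨⟨Nat.find hex, by omega⟩, fun i => ?_⟩
  simp only [Fin.lt_def, Fin.val_castSucc]
  constructor
  · intro h
    have := Nat.find_min hex h
    push Not at this
    exact this.2
  · intro h
    by_contra hc
    push Not at hc
    have hs := Nat.find_spec hex (by omega)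
    rcases hc.eq_or_lt with h' | h'
    · exact hs (by convert h)
    · exact hs (hP _ i (by simpa [Fin.lt_def] using h') h)

theorem aux_delR {k n : ℕ} (hk : k ≤ n) (h : Matrix (Fin (n + 1)) (Fin (n + 1)) ℝ)
    (r : Fin (n + 1)) (hr : ∀ b, b ≠ Fin.last n → h r b = 0) (f' : Fin k → Fin n)
    (hf' : StrictMono f') :
    ∃ p : Fin (k + 1), StrictMono (p.insertNth r (r.succAbove ∘ f') : Fin (k + 1) → Fin (n + 1)) ∧
      det (h.submatrix (p.insertNth r (r.succAbove ∘ f') : Fin (k + 1) → Fin (n + 1))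
        (rcol (Nat.succ_le_succ hk))) =
      h r (Fin.last n) * det ((delM r h).submatrix f' (rcol hk)) := by
  obtain ⟨p, hp⟩ := aux_exists_p (fun i => (f' i).castSucc < r)
    (fun i j hij hj => lt_trans (by simpa using hf' hij) hj)
  refine ⟨p, aux_insert_mono p r _ ((Fin.strictMono_succAbove r).comp hf') ?_ ?_, ?_⟩
  · intro i hi
    exact (Fin.succAbove_lt_iff_castSucc_lt _ _).2 ((hp i).1 hi)
  · intro i hi
    refine (Fin.lt_succAbove_iff_le_castSucc _ _).2 ?_
    by_contra hc
    exact absurd ((hp i).2 (not_le.1 hc)) (not_lt.2 hi)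
  · have hl : rcol (Nat.succ_le_succ hk) (Fin.last k) = Fin.last n := by
      ext; simp [rcol]; omega
    have e1 : (delM r h).submatrix f' (rcol hk) =
        Matrix.of fun i j => sg p i * (h.submatrix (r.succAbove ∘ f')
          (fun j => (rcol hk j).castSucc)) i j := by
      ext i j
      simp only [delM, submatrix_apply, of_apply, Function.comp]
      congr 1
      simp only [sg, hp i]
    rw [e1, det_mul_column, aux_prod_sg, det_succ_row _ p, Finset.sum_eq_single (Fin.last k)]
    · have e2 : ((h.submatrix (p.insertNth r (r.succAbove ∘ f') : Fin (k + 1) → Fin (n + 1))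
        (rcol (Nat.succ_le_succ hk))).submatrix p.succAbove (Fin.last k).succAbove) =
          h.submatrix (r.succAbove ∘ f') (fun j => (rcol hk j).castSucc) := by
        ext i j
        simp only [submatrix_apply, Fin.insertNth_apply_succAbove, Fin.succAbove_last]
        congr 1
        ext
        simp [rcol]
      rw [e2]
      simp only [submatrix_apply, Fin.insertNth_apply_same, hl, Fin.val_last]
      have : (-1 : ℝ) ^ ((p : ℕ) + k) = (-1) ^ (k - (p : ℕ)) := by
        have : (p : ℕ) + k = (k - p) + 2 * p := by omega
        rw [this, pow_add, pow_mul]; simp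
      rw [this]; ring
    · intro j _ hj
      simp only [submatrix_apply, Fin.insertNth_apply_same]
      rw [hr, mul_zero, zero_mul]
      intro hc
      apply hj
      rw [← hl] at hc
      ext
      have := congrArg Fin.val hc
      simp [rcol] at this
      simpa using this
    · simp

theorem aux_delRG {k n : ℕ} (hk : k ≤ n) (w : Fin (n + 1) → Fin (n + 1)) (w' : Fin n → Fin n)
    (hw : ∀ j, w j.castSucc = (w (Fin.last n)).succAbove (w' j)) (f' : Fin k → Fin n)
    (hf : RG w' hk f') (p : Fin (k + 1)) :
    RG w (Nat.succ_le_succ hk) (p.insertNth (w (Fin.last n)) ((w (Fin.last n)).succAbove ∘ f') :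
      Fin (k + 1) → Fin (n + 1)) := by
  obtain ⟨σ, hσ, hle⟩ := hf
  refine ⟨(Fin.snoc (p.succAbove ∘ σ) p : Fin (k + 1) → Fin (k + 1)), ?_, ?_⟩
  · intro a b
    refine Fin.lastCases ?_ (fun a => ?_) a <;> refine Fin.lastCases ?_ (fun b => ?_) b
    · simp
    · simp only [Fin.snoc_last, Fin.snoc_castSucc, Function.comp]
      intro h; exact absurd h.symm (Fin.succAbove_ne _ _)
    · simp only [Fin.snoc_last, Fin.snoc_castSucc, Function.comp]
      intro h; exact absurd h (Fin.succAbove_ne _ _)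
    · simp only [Fin.snoc_castSucc, Function.comp]
      intro h
      rw [hσ (Fin.succAbove_right_injective h)]
  · intro i
    refine Fin.lastCases ?_ (fun i => ?_) i
    · have hl : rcol (Nat.succ_le_succ hk) (Fin.last k) = Fin.last n := by
        ext; simp [rcol]; omega
      simp [hl]
    · have hl : rcol (Nat.succ_le_succ hk) i.castSucc = (rcol hk i).castSucc := by
        ext; simp [rcol]
      simp only [hl, Fin.snoc_castSucc, Function.comp, Fin.insertNth_apply_succAbove, hw]
      exact (Fin.strictMono_succAbove _).monotone (hle i)

theorem aux_delg {n : ℕ} (h g : Matrix (Fin (n + 1)) (Fin (n + 1)) ℝ) (hg : g * hᵀ = 1)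
    (r : Fin (n + 1)) (hr : ∀ b, b ≠ Fin.last n → h r b = 0) :
    (∀ a, a ≠ r → g a (Fin.last n) = 0) ∧ g r (Fin.last n) * h r (Fin.last n) = 1 ∧
      delM r g * (delM r h)ᵀ = 1 := by
  have key : ∀ a a', ∑ b, g a b * h a' b = if a = a' then 1 else 0 := by
    intro a a'
    have := congrFun (congrFun hg a) a'
    simpa [Matrix.mul_apply, Matrix.one_apply] using this
  have key2 : ∀ a, g a (Fin.last n) * h r (Fin.last n) = if a = r then 1 else 0 := by
    intro a
    rw [← key, Finset.sum_eq_single (Fin.last n)]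
    · intro b _ hb; rw [hr b hb, mul_zero]
    · simp
  have h1 : g r (Fin.last n) * h r (Fin.last n) = 1 := by simpa using key2 r
  have h2 : ∀ a, a ≠ r → g a (Fin.last n) = 0 := by
    intro a ha
    have := key2 a
    rw [if_neg ha] at this
    exact (mul_eq_zero.1 this).resolve_right (right_ne_zero_of_mul_eq_one h1)
  refine ⟨h2, h1, ?_⟩
  ext a a'
  have := key (r.succAbove a) (r.succAbove a')
  rw [Fin.sum_univ_castSucc, h2 _ (Fin.succAbove_ne _ _), zero_mul, add_zero] at this
  simp only [Matrix.mul_apply, transpose_apply, delM, of_apply, Matrix.one_apply]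
  have e : ∀ b : Fin n, sg r a * g (r.succAbove a) b.castSucc * (sg r a' *
    h (r.succAbove a') b.castSucc) = (sg r a * sg r a') *
      (g (r.succAbove a) b.castSucc * h (r.succAbove a') b.castSucc) := fun b => by ring
  simp only [e]
  rw [← Finset.mul_sum, this]
  by_cases haa : a = a'
  · subst haa
    simp only [if_true, mul_one, sg]
    split_ifs <;> norm_num
  · have : r.succAbove a ≠ r.succAbove a' := fun hc => haa (Fin.succAbove_right_injective hc)
    simp [haa]


theorem aux_delT1 {m n : ℕ} (hm : m ≤ n) (g : Matrix (Fin (n + 1)) (Fin (n + 1)) ℝ)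
    (r : Fin (n + 1)) (hg : ∀ a, a ≠ r → g a (Fin.last n) = 0) (hr : (r : ℕ) < m + 1)
    (κ' : Fin m → Fin n) :
    det (g.submatrix (Fin.castLE (Nat.succ_le_succ hm))
      (Fin.snoc (fun i => (κ' i).castSucc) (Fin.last n) : Fin (m + 1) → Fin (n + 1))) =
      g r (Fin.last n) * det ((delM r g).submatrix (Fin.castLE hm) κ') := by
  set r' : Fin (m + 1) := ⟨r, hr⟩ with hr'
  have hrr : Fin.castLE (Nat.succ_le_succ hm) r' = r := by ext; simp [hr']
  have hrow : ∀ i : Fin m, Fin.castLE (Nat.succ_le_succ hm) (r'.succAbove i) =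
      r.succAbove (Fin.castLE hm i) := by
    intro i
    ext
    simp only [Fin.succAbove, Fin.lt_def, hr', Fin.val_castLE, Fin.val_castSucc]
    split_ifs <;> simp
  have e1 : (delM r g).submatrix (Fin.castLE hm) κ' =
      Matrix.of fun i j => sg r' i * (g.submatrix (fun i => r.succAbove (Fin.castLE hm i))
        (fun j => (κ' j).castSucc)) i j := by
    ext i j
    simp only [delM, submatrix_apply, of_apply]
    congr 1
  rw [e1, det_mul_column, aux_prod_sg, det_succ_column _ (Fin.last m), Finset.sum_eq_single r']
  · have e2 : (g.submatrix (Fin.castLE (Nat.succ_le_succ hm))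
      (Fin.snoc (fun i => (κ' i).castSucc) (Fin.last n) : Fin (m + 1) → Fin (n + 1))).submatrix
        r'.succAbove (Fin.last m).succAbove = (g.submatrix (fun i => r.succAbove (Fin.castLE hm i))
        (fun j => (κ' j).castSucc)) := by
      ext i j
      simp only [submatrix_apply, hrow, Fin.succAbove_last, Fin.snoc_castSucc]
    rw [e2]
    simp only [submatrix_apply, Fin.snoc_last, hrr, Fin.val_last]
    have : (-1 : ℝ) ^ ((r' : ℕ) + m) = (-1) ^ (m - (r' : ℕ)) := by
      have : (r' : ℕ) + m = (m - r') + 2 * r' := by omega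
      rw [this, pow_add, pow_mul]; simp
    rw [this]; ring
  · intro j _ hj
    simp only [submatrix_apply, Fin.snoc_last]
    rw [hg, mul_zero, zero_mul]
    intro hc
    apply hj
    rw [← hrr] at hc
    ext
    have := congrArg Fin.val hc
    simpa using this
  · simp

theorem aux_delT2 {m n : ℕ} (hm : m ≤ n) (g : Matrix (Fin (n + 1)) (Fin (n + 1)) ℝ)
    (r : Fin (n + 1)) (hr : m ≤ (r : ℕ)) (κ' : Fin m → Fin n) :
    det (g.submatrix (Fin.castLE (Nat.le_succ_of_le hm)) (fun i => (κ' i).castSucc)) =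
      det ((delM r g).submatrix (Fin.castLE hm) κ') := by
  congr 1
  ext i j
  have hlt : (Fin.castLE hm i).castSucc < r := by
    simp only [Fin.lt_def, Fin.val_castSucc, Fin.val_castLE]; omega
  simp only [delM, submatrix_apply, of_apply, sg, if_pos hlt, one_mul]
  rw [Fin.succAbove_of_castSucc_lt _ _ hlt]
  rfl

/-- zero lemma. -/
theorem aux_Tzero {m n : ℕ} (hm : m ≤ n) (w : Fin n → Fin n) (hw : Function.Bijective w)
    (g : Matrix (Fin n) (Fin n) ℝ) (hg : ∀ j b, j < b → g (w j) b = 0) (κ : Fin m → Fin n)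
    (hκ : ¬ TG w κ) : det (g.submatrix (Fin.castLE hm) κ) = 0 := by
  by_contra hne
  obtain ⟨σ, hσ⟩ := aux_transversal _ hne
  apply hκ
  intro t
  choose u hu using hw.2
  have hu' : ∀ i, κ i ≤ u (Fin.castLE hm (σ i)) := by
    intro i
    by_contra hc
    push Not at hc
    have := hg _ _ hc
    rw [hu] at this
    exact hσ i (by simpa using this)
  simp only [cntK, cntX, ← Finset.card_filter]
  refine Finset.card_le_card_of_injOn (fun i => u (Fin.castLE hm (σ i))) ?_ ?_
  · intro i hi
    simp only [coe_filter, mem_univ, true_and, Set.mem_ofPred_eq] at hi ⊢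
    refine ⟨hi.trans (hu' i), ?_⟩
    rw [hu]; simp
  · intro i _ j _ hij
    have := congrArg w hij
    simp only [hu] at this
    exact σ.injective (Fin.castLE_injective hm this)

theorem aux_TG1 {m n : ℕ} (w : Fin (n + 1) → Fin (n + 1)) (w' : Fin n → Fin n)
    (hw : ∀ j, w j.castSucc = (w (Fin.last n)).succAbove (w' j))
    (hr : (w (Fin.last n) : ℕ) < m + 1) (κ' : Fin m → Fin n)
    (hT : TG w (Fin.snoc (fun i => (κ' i).castSucc) (Fin.last n) : Fin (m + 1) → Fin (n + 1))) :
    TG w' κ' := by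
  intro t
  have := hT t
  simp only [cntK, cntX, Fin.sum_univ_castSucc, Fin.snoc_castSucc, Fin.snoc_last, hw,
    Fin.val_castSucc, Fin.val_last, hr, and_true] at this
  simp only [cntK, cntX]
  have e : ∀ j : Fin n, (((w (Fin.last n)).succAbove (w' j) : ℕ) < m + 1) ↔ (w' j : ℕ) < m := by
    intro j
    simp only [Fin.succAbove, Fin.lt_def, Fin.val_castSucc]
    split_ifs <;> simp <;> omega
  simp only [e] at this
  omega

theorem aux_TG2 {m n : ℕ} (w : Fin (n + 1) → Fin (n + 1)) (w' : Fin n → Fin n)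
    (hw : ∀ j, w j.castSucc = (w (Fin.last n)).succAbove (w' j))
    (hr : m ≤ (w (Fin.last n) : ℕ)) (κ' : Fin m → Fin n)
    (hT : TG w (fun i => (κ' i).castSucc)) :
    TG w' κ' := by
  intro t
  have := hT t
  simp only [cntK, cntX, Fin.sum_univ_castSucc (n := n), hw,
    Fin.val_castSucc, Fin.val_last, not_lt.2 hr, and_false, if_false, add_zero] at this
  simp only [cntK, cntX]
  have e : ∀ j : Fin n, (((w (Fin.last n)).succAbove (w' j) : ℕ) < m) ↔ (w' j : ℕ) < m := by
    intro j
    simp only [Fin.succAbove, Fin.lt_def, Fin.val_castSucc]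
    split_ifs <;> simp <;> omega
  simp only [e] at this
  exact this

theorem aux_snoc_mono {k n : ℕ} (v : Fin k → Fin n) (hv : StrictMono v) (x : Fin n)
    (hx : ∀ i, v i < x) : StrictMono (Fin.snoc v x : Fin (k + 1) → Fin n) := by
  intro a b
  refine Fin.lastCases ?_ (fun a => ?_) a <;> refine Fin.lastCases ?_ (fun b => ?_) b
  · simp
  · intro h; exact absurd h (by simp [Fin.le_last])
  · intro _; simpa using hx a
  · intro h; simpa using hv (by simpa using h)

theorem aux_cntX_mono {n : ℕ} (w : Fin n → Fin n) {m m' : ℕ} (h : m ≤ m') (t : ℕ) :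
    cntX w m t ≤ cntX w m' t := by
  refine Finset.sum_le_sum fun j _ => ?_
  split_ifs with h1 h2 h2
  · rfl
  · exact absurd ⟨h1.1, by omega⟩ h2
  · simp
  · rfl

theorem aux_cntX_ge {n : ℕ} (w : Fin n → Fin n) (hw : Function.Bijective w) {m : ℕ} (hm : m ≤ n)
    (t : ℕ) : m ≤ cntX w m t + t := by
  choose u hu using hw.2
  simp only [cntX, ← Finset.card_filter]
  have h1 : m ≤ (univ.filter fun j : Fin n => (w j : ℕ) < m).card := by
    calc m = (univ : Finset (Fin m)).card := by simp
      _ ≤ _ := Finset.card_le_card_of_injOn (fun i => u (Fin.castLE hm i)) (by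
          intro i _; simp [hu]) (by
          intro i _ j _ hij
          have := congrArg w hij
          simp only [hu] at this
          exact Fin.castLE_injective hm this)
  have h2 : (univ.filter fun j : Fin n => (j : ℕ) < t).card ≤ t := by
    calc _ ≤ (Finset.range t).card := Finset.card_le_card_of_injOn (fun j : Fin n => (j : ℕ)) (by
            intro j hj; simpa using hj) (by
            intro i _ j _ hij; exact Fin.ext hij)
      _ = t := by simp
  have h3 : (univ.filter fun j : Fin n => (w j : ℕ) < m) ⊆
      (univ.filter fun j : Fin n => t ≤ (j : ℕ) ∧ (w j : ℕ) < m) ∪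
      (univ.filter fun j : Fin n => (j : ℕ) < t) := by
    intro j hj
    simp only [mem_filter, mem_univ, true_and, mem_union] at hj ⊢
    omega
  have h4 := (Finset.card_le_card h3).trans (Finset.card_union_le _ _)
  omega

theorem aux_trouble {n s : ℕ} (w : Fin (n + 1) → Fin (n + 1)) (hw : Function.Bijective w)
    (g : Matrix (Fin (n + 1)) (Fin (n + 1)) ℝ) (hm : s + 2 ≤ n + 1) (hm' : s + 1 ≤ n + 1)
    (κ : Fin (s + 1) → Fin (n + 1)) (hκ : StrictMono κ) (hlast : κ (Fin.last s) < Fin.last n)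
    (hT : TG w κ) (hr : (w (Fin.last n) : ℕ) < s + 1) (hnt : ∃ i, (κ i : ℕ) ≠ i)
    (hA : ∀ κ2 : Fin (s + 1) → Fin (n + 1), StrictMono κ2 → κ2 (Fin.last s) = Fin.last n →
      TG w κ2 → 0 < det (g.submatrix (Fin.castLE hm') κ2))
    (hB : ∀ κ2 : Fin (s + 2) → Fin (n + 1), StrictMono κ2 →
      TG w κ2 → 0 < det (g.submatrix (Fin.castLE hm) κ2))
    (hC : ∀ κ2 : Fin (s + 1) → Fin (n + 1), StrictMono κ2 → ∑ i, (κ2 i : ℕ) < ∑ i, (κ i : ℕ) →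
      0 ≤ det (g.submatrix (Fin.castLE hm') κ2))
    (hD : ∀ κ2 : Fin (s + 2) → Fin (n + 1), StrictMono κ2 →
      0 ≤ det (g.submatrix (Fin.castLE hm) κ2)) :
    0 < det (g.submatrix (Fin.castLE hm') κ) := by
  -- `p` minimal with `κ p ≠ p`
  obtain ⟨p, hp1, hp2⟩ : ∃ p : Fin (s + 1), (κ p : ℕ) ≠ p ∧ ∀ i < p, (κ i : ℕ) = i := by
    obtain ⟨p, hp, hmin⟩ := WellFounded.has_min (wellFounded_lt (α := Fin (s + 1)))
      {i | (κ i : ℕ) ≠ i} hnt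
    exact ⟨p, hp, fun i hi => by by_contra hc; exact hmin i hc hi⟩
  have hge : ∀ i : Fin (s + 1), (i : ℕ) ≤ κ i := by
    intro i
    obtain ⟨i, hi⟩ := i
    induction i with
    | zero => simp
    | succ i ih =>
      have h1 := ih (by omega)
      have h2 : κ ⟨i, by omega⟩ < κ ⟨i + 1, hi⟩ := hκ (by simp [Fin.lt_def])
      simp only [Fin.lt_def] at h2 h1 ⊢
      omega
  have hpp : (p : ℕ) < κ p := lt_of_le_of_ne (hge p) (Ne.symm hp1)
  set L := Fin.last n with hL
  set c := κ (Fin.last s) with hc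
  have hpc : (p : ℕ) < c := lt_of_lt_of_le hpp (hκ.monotone (Fin.le_last p))
  set b : Fin (n + 1) := ⟨p, by omega⟩ with hb
  set α : Fin s → Fin (n + 1) := fun i => κ i.castSucc with hα
  have hαm : StrictMono α := fun i j hij => hκ (by simpa using hij)
  have hαc : ∀ i, α i < c := fun i => hκ (Fin.castSucc_lt_last i)
  have hκs : κ = Fin.snoc α c := by
    ext i; refine Fin.lastCases ?_ (fun i => ?_) i <;> simp [hα, hc]
  have hbL : b < L := by simp only [Fin.lt_def, hb, hL, Fin.val_last] at hlast ⊢; omega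
  have hbc : b < c := hpc
  set β : Fin (s + 1) → Fin (n + 1) := p.insertNth b α with hβ
  have hβm : StrictMono β := by
    apply aux_insert_mono p b α hαm
    · intro i hi
      have := hp2 _ hi
      simp only [Fin.lt_def, hα, hb]
      rw [this]; exact hi
    · intro i hi
      have : κ p ≤ α i := hκ.monotone hi
      simp only [Fin.lt_def, hb]
      exact lt_of_lt_of_le hpp this
  have hβc : ∀ i, β i < c := by
    intro i; refine Fin.succAboveCases p ?_ (fun i => ?_) i
    · simpa [hβ] using hbc
    · simpa [hβ] using hαc i
  have hβL : ∀ i, β i < L := fun i => (hβc i).trans hlast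
  have hαL : ∀ i, α i < L := fun i => (hαc i).trans hlast
  -- sum
  have hsum : ∑ i, (β i : ℕ) < ∑ i, (κ i : ℕ) := by
    rw [hκs, Fin.sum_univ_succAbove _ p, Fin.sum_univ_castSucc]
    simp only [hβ, Fin.insertNth_apply_same, Fin.insertNth_apply_succAbove, Fin.snoc_castSucc,
      Fin.snoc_last]
    have : (b : ℕ) < c := hbc
    omega
  -- counting
  have cα : ∀ t x, cntK (Fin.snoc α x : Fin (s + 1) → Fin (n + 1)) t =
      cntK α t + if t ≤ (x : ℕ) then 1 else 0 := by
    intro t x; simp only [cntK]; rw [Fin.sum_univ_castSucc]; simp only [Fin.snoc_castSucc, Fin.snoc_last]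
  have cβ' : ∀ t, cntK β t = (if t ≤ (b : ℕ) then 1 else 0) + cntK α t := by
    intro t; simp [cntK, Fin.sum_univ_succAbove _ p, hβ]
  have cβ : ∀ t x, cntK (Fin.snoc β x : Fin (s + 2) → Fin (n + 1)) t =
      cntK β t + if t ≤ (x : ℕ) then 1 else 0 := by
    intro t x; simp only [cntK]; rw [Fin.sum_univ_castSucc]; simp only [Fin.snoc_castSucc, Fin.snoc_last]
  have cα0 : ∀ t, (c : ℕ) < t → cntK α t = 0 := by
    intro t ht
    simp only [cntK]
    refine Finset.sum_eq_zero fun i _ => ?_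
    rw [if_neg]
    have : (α i : ℕ) < c := hαc i
    omega
  have T1 : TG w (Fin.snoc α L : Fin (s + 1) → Fin (n + 1)) := by
    intro t
    rw [cα]
    by_cases htc : t ≤ (c : ℕ)
    · have := hT t
      rw [hκs, cα, if_pos htc] at this
      have hc' : (c : ℕ) < L := hlast
      rw [if_pos (by omega)]
      exact this
    · rw [cα0 t (by omega)]
      split_ifs with htL
      · simp only [cntX, zero_add]
        refine le_trans ?_ (Finset.single_le_sum (fun _ _ => Nat.zero_le _) (Finset.mem_univ L))
        rw [if_pos ⟨htL, hr⟩]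
      · simp
  have T2 : TG w (Fin.snoc β L : Fin (s + 2) → Fin (n + 1)) := by
    intro t
    by_cases htb : t ≤ (b : ℕ)
    · have h1 := aux_cntX_ge w hw hm t
      have h2 : cntK α t + t ≤ s := by
        simp only [cntK, ← Finset.card_filter]
        have hps : (p : ℕ) ≤ s := by omega
        have hts : t ≤ s := le_trans htb hps
        have h5 : ((univ : Finset (Fin t)).map (Fin.castLEEmb hts)) ⊆
            univ.filter (fun i : Fin s => ¬ t ≤ (α i : ℕ)) := by
          intro i hi
          simp only [mem_map, mem_univ, true_and] at hi
          obtain ⟨a, rfl⟩ := hi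
          simp only [mem_filter, mem_univ, true_and, hα]
          rw [hp2]
          · simp
          · simp only [Fin.lt_def]
            have : (a : ℕ) < t := a.2
            simp only [hb] at htb
            simp
            omega
        have h6 := Finset.card_le_card h5
        simp only [card_map, card_univ, Fintype.card_fin] at h6
        have h7 := Finset.card_filter_add_card_filter_not (s := (univ : Finset (Fin s)))
          (fun i : Fin s => t ≤ (α i : ℕ))
        simp only [card_univ, Fintype.card_fin] at h7
        omega
      rw [cβ, cβ']
      change _ ≤ cntX w (s + 2) t
      split_ifs <;> omega
    · rw [cβ, cβ', if_neg htb]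
      have := T1 t
      rw [cα] at this
      rw [zero_add]
      exact this.trans (aux_cntX_mono w (by omega) t)
  have T3 : TG w (Fin.snoc β c : Fin (s + 2) → Fin (n + 1)) := by
    intro t
    refine le_trans ?_ (T2 t)
    rw [cβ, cβ]
    have hc' : (c : ℕ) < L := hlast
    split_ifs <;> omega
  -- positivity
  have P1 := hB _ (aux_snoc_mono β hβm L hβL) T2
  have P2 := hB _ (aux_snoc_mono β hβm c hβc) T3
  have P3 := hA _ (aux_snoc_mono α hαm L hαL) (by simp [hL]) T1
  have P4 := hC β hβm hsum
  have P5 := hD _ (aux_snoc_mono κ hκ L (fun i => lt_of_le_of_lt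
    (hκ.monotone (Fin.le_last i)) hlast))
  -- the relation
  let col : Fin (n + 1) → Fin (s + 2) → ℝ := fun j a => g (Fin.castLE hm a) j
  let e : Fin (s + 2) → ℝ := Pi.single (Fin.last (s + 1)) 1
  have rel := aux_three (fun i => col (α i)) (col b) (col c) (col L) e
  obtain ⟨ε, hε, hsgn⟩ := aux_sign (s := s + 1) p.castSucc (Fin.last s).castSucc
  have hins : ∀ (q : Fin (s + 1)) (x y : Fin (s + 2) → ℝ) (a : Fin s → Fin (s + 2) → ℝ),
      (q.castSucc.insertNth x (Fin.snoc a y : Fin (s + 1) → Fin (s + 2) → ℝ) :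
        Fin (s + 2) → Fin (s + 2) → ℝ) =
      Fin.snoc (q.insertNth x a : Fin (s + 1) → Fin (s + 2) → ℝ) y := by
    intro q x y a
    rw [Fin.insertNth_eq_iff]
    refine ⟨by simp, ?_⟩
    funext i
    refine Fin.lastCases ?_ (fun i => ?_) i
    · simp [Fin.removeNth]
    · simp [Fin.removeNth]
  have hdet : ∀ κ2 : Fin (s + 2) → Fin (n + 1),
      det (Matrix.of (fun i => col (κ2 i))) = det (g.submatrix (Fin.castLE hm) κ2) := by
    intro κ2
    rw [← det_transpose]
    rfl
  have hdet' : ∀ κ2 : Fin (s + 1) → Fin (n + 1),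
      det (Matrix.of (Fin.snoc (fun i => col (κ2 i)) e : Fin (s + 2) → Fin (s + 2) → ℝ)) =
        det (g.submatrix (Fin.castLE hm') κ2) := by
    intro κ2
    rw [aux_trunc, ← det_transpose]
    rfl
  have hs1 : ∀ (v : Fin s → Fin (n + 1)) (x : Fin (n + 1)),
      (Fin.snoc (fun i => col (v i)) (col x) : Fin (s + 1) → Fin (s + 2) → ℝ) =
        fun i => col ((Fin.snoc v x : Fin (s + 1) → Fin (n + 1)) i) := by
    intro v x
    funext i
    refine Fin.lastCases ?_ (fun i => ?_) i <;> simp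
  have hs2 : ∀ (v : Fin (s + 1) → Fin (n + 1)) (x : Fin (n + 1)),
      (Fin.snoc (fun i => col (v i)) (col x) : Fin (s + 2) → Fin (s + 2) → ℝ) =
        fun i => col ((Fin.snoc v x : Fin (s + 2) → Fin (n + 1)) i) := by
    intro v x
    funext i
    refine Fin.lastCases ?_ (fun i => ?_) i <;> simp
  have hs3 : (p.insertNth (col b) (fun i => col (α i)) : Fin (s + 1) → Fin (s + 2) → ℝ) =
        fun i => col (β i) := by
    rw [Fin.insertNth_eq_iff]
    refine ⟨by simp [hβ], ?_⟩
    funext i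
    simp [hβ, Fin.removeNth]
  have hb' : ∀ y : Fin (s + 2) → ℝ,
      det (Matrix.of (Fin.snoc (fun i => col (β i)) y : Fin (s + 2) → Fin (s + 2) → ℝ)) =
      ε * det (Matrix.of (Fin.snoc (Fin.snoc (fun i => col (α i)) (col b) :
        Fin (s + 1) → Fin (s + 2) → ℝ) y : Fin (s + 2) → Fin (s + 2) → ℝ)) := by
    intro y
    have := hsgn (col b) (Fin.snoc (fun i => col (α i)) y : Fin (s + 1) → Fin (s + 2) → ℝ)
    rw [hins, hins, hs3, Fin.insertNth_last'] at this
    exact this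
  have q1 := hb' (col L)
  have q2 := hb' (col c)
  have q3 := hb' e
  rw [hs2, hdet] at q1 q2
  rw [hdet'] at q3
  simp only [] at rel
  rw [hs1 α c, hs1 α L, hs2, hdet, hdet', hdet', ← hκs] at rel
  have main : det (g.submatrix (Fin.castLE hm) (Fin.snoc β L : Fin (s + 2) → Fin (n + 1))) *
      det (g.submatrix (Fin.castLE hm') κ) =
      det (g.submatrix (Fin.castLE hm) (Fin.snoc κ L : Fin (s + 2) → Fin (n + 1))) *
      det (g.submatrix (Fin.castLE hm') β) +
      det (g.submatrix (Fin.castLE hm) (Fin.snoc β c : Fin (s + 2) → Fin (n + 1))) *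
      det (g.submatrix (Fin.castLE hm') (Fin.snoc α L : Fin (s + 1) → Fin (n + 1))) := by
    rw [q1, q2, q3]
    linear_combination ε * rel
  have hpos : 0 < det (g.submatrix (Fin.castLE hm) (Fin.snoc β L : Fin (s + 2) → Fin (n + 1))) *
      det (g.submatrix (Fin.castLE hm') κ) := by
    rw [main]
    have := mul_nonneg P5 P4
    have := mul_pos P2 P3
    linarith
  exact (mul_pos_iff_of_pos_left P1).1 hpos

theorem aux_gsupp2 {n : ℕ} (w : Fin n → Fin n) (hw : Function.Bijective w)
    (h g : Matrix (Fin n) (Fin n) ℝ) (hg : g * hᵀ = 1)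
    (h2 : ∀ b b', b < b' → h (w b') b = 0) : ∀ j b, j < b → g (w j) b = 0 := by
  set q := h.submatrix w id with hq
  set q' := gᵀ.submatrix id w with hq'
  have hg' : h * gᵀ = 1 := by
    have := congrArg transpose hg
    simpa using this
  have e : q * q' = 1 := by
    rw [hq, hq', ← submatrix_mul h gᵀ w id w Function.bijective_id, hg']
    exact submatrix_one w hw.1
  have bt : BlockTriangular q id := fun i j hij => h2 _ _ hij
  have : Invertible q := invertibleOfRightInverse _ _ e
  have := blockTriangular_inv_of_blockTriangular bt
  rw [inv_eq_right_inv e] at this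
  intro j b hjb
  exact this hjb

theorem aux_gsupp1 {n : ℕ} (w : Fin n → Fin n) (hw : Function.Bijective w)
    (h g : Matrix (Fin n) (Fin n) ℝ) (hg : g * hᵀ = 1)
    (h1 : ∀ a b, a < w b → h a b = 0) : ∀ a b, w b < a → g a b = 0 := by
  set q := h.submatrix w id with hq
  set q' := gᵀ.submatrix id w with hq'
  have hg' : h * gᵀ = 1 := by
    have := congrArg transpose hg
    simpa using this
  have e : q * q' = 1 := by
    rw [hq, hq', ← submatrix_mul h gᵀ w id w Function.bijective_id, hg']
    exact submatrix_one w hw.1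
  have bt : BlockTriangular q (fun i => OrderDual.toDual (w i)) := fun i j hij => h1 _ _ hij
  have : Invertible q := invertibleOfRightInverse _ _ e
  have := blockTriangular_inv_of_blockTriangular bt
  rw [inv_eq_right_inv e] at this
  intro a b hab
  obtain ⟨i, rfl⟩ := hw.2 a
  exact this hab

theorem aux_rank {k m : ℕ} (u : Fin k → Fin (m + k)) (hu : Function.Injective u) :
    ∃ σ : Fin k → Fin k, Function.Injective σ ∧ ∀ i, (u i : ℕ) ≤ m + σ i := by
  have hlt : ∀ i, (univ.filter fun j => u j < u i).card < k := by
    intro i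
    calc _ < (univ : Finset (Fin k)).card := Finset.card_lt_card (by
          rw [Finset.ssubset_univ_iff]
          intro hc
          have : i ∈ (univ.filter fun j => u j < u i) := by rw [hc]; simp
          simp at this)
      _ = k := by simp
  refine ⟨fun i => ⟨(univ.filter fun j => u j < u i).card, hlt i⟩, ?_, ?_⟩
  · have key : ∀ i j, u i < u j →
        (univ.filter fun l => u l < u i).card < (univ.filter fun l => u l < u j).card := by
      intro i j hij
      refine Finset.card_lt_card ⟨fun l hl => ?_, fun hc => ?_⟩
      · simp only [mem_filter, mem_univ, true_and] at hl ⊢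
        exact hl.trans hij
      · have := hc (show i ∈ _ by simpa using hij)
        simp at this
    intro i j hij
    simp only [Fin.mk.injEq] at hij
    by_contra hne
    rcases lt_or_gt_of_ne (fun hc => hne (hu hc)) with h | h
    · have := key _ _ h; omega
    · have := key _ _ h; omega
  · intro i
    have h1 := Finset.card_filter_add_card_filter_not (s := (univ : Finset (Fin k)))
      (fun j => u j < u i)
    have h2 : (univ.filter fun j => ¬ u j < u i).card ≤ (Finset.Ici (u i)).card :=
      Finset.card_le_card_of_injOn u (by intro j hj; simpa using hj) hu.injOn
    simp only [Fin.card_Ici, card_univ, Fintype.card_fin] at h1 h2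
    have := (u i).2
    simp only
    omega

theorem aux_P : ∀ (n : ℕ) (w : Fin n → Fin n), Function.Bijective w →
    ∀ (h g : Matrix (Fin n) (Fin n) ℝ), g * hᵀ = 1 →
    (∀ b b', b < b' → h (w b') b = 0) →
    (∀ (k : ℕ) (hk : k ≤ n) (f : Fin k → Fin n), StrictMono f → RG w hk f →
      0 < det (h.submatrix f (rcol hk))) →
    ∀ (m : ℕ) (hm : m ≤ n) (κ : Fin m → Fin n), StrictMono κ → TG w κ →
      0 < det (g.submatrix (Fin.castLE hm) κ) := by
  intro n
  induction n with
  | zero =>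
    intro w hw h g hg h2 gen m hm κ hκ hT
    obtain rfl : m = 0 := by omega
    simp
  | succ n IH =>
    intro w hw h g hg h2 gen
    have hgs := aux_gsupp2 w hw h g hg h2
    set r := w (Fin.last n) with hr
    have hrow : ∀ b, b ≠ Fin.last n → h r b = 0 := fun b hb =>
      h2 _ _ (lt_of_le_of_ne (Fin.le_last b) hb)
    have hw'ex : ∀ j : Fin n, ∃ a, r.succAbove a = w j.castSucc := fun j =>
      Fin.exists_succAbove_eq (fun hc => absurd (hw.1 hc) (Fin.castSucc_lt_last j).ne)
    choose w' hw' using hw'ex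
    replace hw' : ∀ j, w j.castSucc = r.succAbove (w' j) := fun j => (hw' j).symm
    have hw'i : Function.Injective w' := by
      intro i j hij
      have : w i.castSucc = w j.castSucc := by rw [hw', hw', hij]
      simpa using hw.1 this
    have hw'b : Function.Bijective w' := Finite.injective_iff_bijective.1 hw'i
    have hrpos : 0 < h r (Fin.last n) := by
      have hrc : rcol (show 1 ≤ n + 1 by omega) 0 = Fin.last n := by ext; simp [rcol]
      have := gen 1 (by omega) (fun _ => r) (fun a b hab => absurd hab (by
        rw [Subsingleton.elim a b]; exact lt_irrefl _)) ⟨id, Function.injective_id, fun i => by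
          rw [Subsingleton.elim i 0, hrc]⟩
      rw [det_fin_one, submatrix_apply, hrc] at this
      exact this
    obtain ⟨d1, d2, d3⟩ := aux_delg h g hg r hrow
    have hgpos : 0 < g r (Fin.last n) := by
      by_contra hc
      push Not at hc
      nlinarith
    have IH' := IH w' hw'b (delM r h) (delM r g) d3 (by
      intro b b' hb
      simp only [delM, of_apply]
      rw [← hw', h2 _ _ (by simpa using hb), mul_zero]) (by
      intro k hk f' hf' hRG
      obtain ⟨p, hp, hdet⟩ := aux_delR hk h r hrow f' hf'
      have := gen (k + 1) (Nat.succ_le_succ hk) _ hp (aux_delRG hk w w' hw' f' hRG p)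
      rw [hdet] at this
      exact (mul_pos_iff_of_pos_left hrpos).1 this)
    -- lowering of maps avoiding the last element
    have lower : ∀ (m : ℕ) (κ : Fin m → Fin (n + 1)), StrictMono κ → (∀ i, κ i < Fin.last n) →
        ∃ κ' : Fin m → Fin n, StrictMono κ' ∧ κ = fun i => (κ' i).castSucc := by
      intro m κ hκ hlt
      refine ⟨fun i => ⟨κ i, hlt i⟩, fun i j hij => hκ hij, ?_⟩
      funext i; ext; simp
    have hA : ∀ (s : ℕ) (hs : s + 1 ≤ n + 1), (r : ℕ) < s + 1 →
        ∀ κ : Fin (s + 1) → Fin (n + 1), StrictMono κ → κ (Fin.last s) = Fin.last n → TG w κ →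
        0 < det (g.submatrix (Fin.castLE hs) κ) := by
      intro s hs hrs κ hκ hl hT
      obtain ⟨κ', hκ', he⟩ := lower s (fun i => κ i.castSucc) (fun i j hij => hκ (by simpa using hij))
        (fun i => by rw [← hl]; exact hκ (Fin.castSucc_lt_last i))
      have hκe : κ = Fin.snoc (fun i => (κ' i).castSucc) (Fin.last n) := by
        rw [← he, ← hl]
        funext i; refine Fin.lastCases ?_ (fun i => ?_) i <;> simp
      rw [hκe] at hT ⊢
      rw [aux_delT1 (by omega) g r d1 hrs κ']
      exact mul_pos hgpos (IH' s (by omega) κ' hκ' (aux_TG1 w w' hw' hrs κ' hT))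
    have hdet : 0 < det h := by
      have := gen (n + 1) le_rfl id strictMono_id (by
        obtain ⟨σ, hσ, hle⟩ := aux_rank (m := 0) (k := n + 1)
          (fun i => Fin.cast (by omega) (w (rcol le_rfl i))) (by
            intro i j hij
            have h3 : w (rcol le_rfl i) = w (rcol le_rfl j) := by
              simpa [Fin.ext_iff] using hij
            have := congrArg Fin.val (hw.1 h3)
            ext
            simpa [rcol] using this)
        refine ⟨σ, hσ, fun i => ?_⟩
        have := hle i
        simp only [Fin.val_cast] at this
        simp only [Fin.le_def, id]; omega)
      have e : h.submatrix id (rcol (le_refl (n + 1))) = h := by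
        ext i j; simp only [submatrix_apply, id]; congr 1; ext; simp [rcol]
      rwa [e] at this
    have hId : ∀ (m : ℕ) (hm : m ≤ n + 1) (κ : Fin m → Fin (n + 1)), (∀ i, (κ i : ℕ) = i) →
        0 < det (g.submatrix (Fin.castLE hm) κ) := by
      intro m hm κ hκ
      have hκe : κ = Fin.castLE hm := by funext i; ext; simp [hκ]
      rw [hκe]
      have hj := aux_jacobi h g hg (n + 1 - m) m (by omega)
      have hrc : rcol (show n + 1 - m ≤ n + 1 by omega) =
          (fun i : Fin (n + 1 - m) => (⟨m + i, by omega⟩ : Fin (n + 1))) := by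
        funext i; ext; simp only [rcol]; omega
      have := gen (n + 1 - m) (by omega) (fun i => ⟨m + i, by omega⟩)
        (fun i j hij => by simp only [Fin.lt_def] at hij ⊢; omega) (by
          obtain ⟨σ, hσ, hle⟩ := aux_rank (m := m) (k := n + 1 - m)
            (fun i => Fin.cast (by omega) (w (rcol (by omega) i))) (by
              intro i j hij
              have h3 : w (rcol (by omega) i) = w (rcol (by omega) j) := by
                simpa [Fin.ext_iff] using hij
              have := congrArg Fin.val (hw.1 h3)
              ext
              simpa [rcol] using this)
          refine ⟨σ, hσ, fun i => ?_⟩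
          have := hle i
          simpa [Fin.le_def] using this)
      rw [hrc, ← hj] at this
      exact (mul_pos_iff_of_pos_left hdet).1 this
    -- descending induction
    have desc : ∀ (d m : ℕ) (hm : m ≤ n + 1), m + d = n + 1 → ∀ κ : Fin m → Fin (n + 1),
        StrictMono κ → TG w κ → 0 < det (g.submatrix (Fin.castLE hm) κ) := by
      intro d
      induction d with
      | zero =>
        intro m hm hd κ hκ hT
        apply hId
        obtain rfl : m = n + 1 := by omega
        intro i
        have : κ = id := by
          have h5 : Function.Bijective κ := Finite.injective_iff_bijective.1 hκ.injective
          have h6 : Set.range κ = Set.range (id : Fin (n + 1) → Fin (n + 1)) := by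
            rw [h5.2.range_eq]; simp
          exact (StrictMono.range_inj hκ strictMono_id).1 h6
        rw [this]; rfl
      | succ d ihd =>
        intro m hm hd
        have inner : ∀ (N : ℕ) (κ : Fin m → Fin (n + 1)), ∑ i, (κ i : ℕ) = N → StrictMono κ →
            TG w κ → 0 < det (g.submatrix (Fin.castLE hm) κ) := by
          intro N
          induction N using Nat.strong_induction_on with
          | _ N ihN =>
            intro κ hN hκ hT
            by_cases hrm : (r : ℕ) < m
            · obtain ⟨s, rfl⟩ : ∃ s, m = s + 1 := ⟨m - 1, by omega⟩
              by_cases hl : κ (Fin.last s) = Fin.last n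
              · exact hA s hm hrm κ hκ hl hT
              · by_cases hnt : ∃ i, (κ i : ℕ) ≠ i
                · refine aux_trouble w hw g (by omega) hm κ hκ
                    (lt_of_le_of_ne (Fin.le_last _) hl) hT hrm hnt ?_ ?_ ?_ ?_
                  · intro κ2 h3 h4 h5; exact hA s hm hrm κ2 h3 h4 h5
                  · intro κ2 h3 h4; exact ihd (s + 2) (by omega) (by omega) κ2 h3 h4
                  · intro κ2 h3 h4
                    by_cases h5 : TG w κ2
                    · exact (ihN _ (hN ▸ h4) κ2 rfl h3 h5).le
                    · exact (aux_Tzero hm w hw g hgs κ2 h5).ge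
                  · intro κ2 h3
                    by_cases h5 : TG w κ2
                    · exact (ihd (s + 2) (by omega) (by omega) κ2 h3 h5).le
                    · exact (aux_Tzero _ w hw g hgs κ2 h5).ge
                · push Not at hnt
                  exact hId _ hm κ hnt
            · have hno : ∀ i, κ i < Fin.last n := by
                intro i
                refine lt_of_le_of_ne (Fin.le_last _) fun hc => ?_
                have h6 := hT n
                have h7 : cntX w m n = 0 := by
                  simp only [cntX]
                  refine Finset.sum_eq_zero fun j _ => ?_
                  rw [if_neg]
                  rintro ⟨h8, h9⟩
                  have : j = Fin.last n := by ext; simp; omega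
                  rw [this] at h9
                  exact hrm h9
                have h8 : 1 ≤ cntK κ n := by
                  simp only [cntK]
                  refine le_trans ?_ (Finset.single_le_sum (fun _ _ => Nat.zero_le _)
                    (Finset.mem_univ i))
                  rw [if_pos (by rw [hc]; simp)]
                omega
              obtain ⟨κ', hκ', he⟩ := lower m κ hκ hno
              rw [he] at hT ⊢
              have hmn : m ≤ n := by omega
              rw [aux_delT2 hmn g r (by omega) κ']
              exact IH' m hmn κ' hκ' (aux_TG2 w w' hw' (by omega) κ' hT)
        intro κ hκ hT
        exact inner _ κ rfl hκ hT
    intro m hm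
    exact desc (n + 1 - m) m hm (by omega)

theorem aux_pred {k n : ℕ} (w : Fin n → Fin n) (hw : Function.Injective w) (hk : k ≤ n)
    (f : Fin k → Fin n) (hf : StrictMono f) (hR : RG w hk f)
    (hne : ¬ ∃ σ : Fin k → Fin k, Function.Injective σ ∧ ∀ i, w (rcol hk i) = f (σ i)) :
    ∃ (i0 : Fin k) (a' : Fin n), (a' : ℕ) + 1 = f i0 ∧
      StrictMono (Function.update f i0 a') ∧ RG w hk (Function.update f i0 a') := by
  have hrc : Function.Injective (rcol hk) := by
    intro i j hij
    have := congrArg Fin.val hij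
    ext
    simpa [rcol] using this
  let S : Set ((Fin k → Fin k) × Fin k) := {x | Function.Injective x.1 ∧
    (∀ i, w (rcol hk i) ≤ f (x.1 i)) ∧ w (rcol hk x.2) < f (x.1 x.2)}
  have hS : S.Nonempty := by
    obtain ⟨σ, h1, h2⟩ := hR
    by_contra hc
    rw [Set.not_nonempty_iff_eq_empty] at hc
    refine hne ⟨σ, h1, fun i => ?_⟩
    by_contra hi
    have : (σ, i) ∈ S := ⟨h1, h2, lt_of_le_of_ne (h2 i) hi⟩
    rw [hc] at this
    exact this
  obtain ⟨⟨σ, i⟩, ⟨h1, h2, h3⟩, hmin⟩ :=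
    WellFounded.has_min (InvImage.wf (fun x : (Fin k → Fin k) × Fin k => f (x.1 x.2))
      (wellFounded_lt (α := Fin n))) S hS
  simp only at h1 h2 h3
  have h3' : (w (rcol hk i) : ℕ) < f (σ i) := h3
  let a' : Fin n := ⟨f (σ i) - 1, by omega⟩
  have ha' : (a' : ℕ) + 1 = f (σ i) := by simp only [a']; omega
  have hσs : Function.Surjective σ := Finite.injective_iff_surjective.1 h1
  have hno : ∀ j, f j ≠ a' := by
    intro j hj
    obtain ⟨i', rfl⟩ := hσs j
    have hne' : i' ≠ i := by
      rintro rfl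
      rw [hj] at ha'; omega
    have e1 : w (rcol hk i') = a' := by
      by_contra hc
      have h4 : w (rcol hk i') < f (σ i') := lt_of_le_of_ne (h2 i') (hj ▸ hc)
      refine hmin (σ, i') ⟨h1, h2, h4⟩ ?_
      change f (σ i') < f (σ i)
      rw [hj, Fin.lt_def]; omega
    have e2 : w (rcol hk i) < a' := by
      refine lt_of_le_of_ne ?_ ?_
      · rw [Fin.le_def]; omega
      · rw [← e1]; intro hc; exact hne' (hrc (hw hc)).symm
    refine hmin (Equiv.swap (σ i) (σ i') ∘ σ, i) ⟨(Equiv.injective _).comp h1, ?_, ?_⟩ ?_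
    · intro l
      simp only [Function.comp]
      by_cases hl : l = i
      · subst hl; rw [Equiv.swap_apply_left, hj]; exact e2.le
      · by_cases hl' : l = i'
        · subst hl'; rw [Equiv.swap_apply_right, e1, Fin.le_def]; omega
        · rw [Equiv.swap_apply_of_ne_of_ne (fun hc => hl (h1 hc)) (fun hc => hl' (h1 hc))]
          exact h2 l
    · simp only [Function.comp]
      rw [Equiv.swap_apply_left, hj]; exact e2
    · change f ((Equiv.swap (σ i) (σ i') ∘ σ) i) < f (σ i)
      simp only [Function.comp]
      rw [Equiv.swap_apply_left, hj, Fin.lt_def]; omega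
  refine ⟨σ i, a', ha', ?_, σ, h1, ?_⟩
  · intro x y hxy
    have hxy' := hf hxy
    by_cases hx : x = σ i
    · subst hx
      rw [Function.update_self, Function.update_of_ne hxy.ne']
      rw [Fin.lt_def] at hxy' ⊢; omega
    · rw [Function.update_of_ne hx]
      by_cases hy : y = σ i
      · subst hy
        rw [Function.update_self]
        have := hno x
        rw [Ne, Fin.ext_iff] at this
        rw [Fin.lt_def] at hxy' ⊢; omega
      · rw [Function.update_of_ne hy]; exact hxy'
  · intro l
    by_cases hl : l = i
    · subst hl; rw [Function.update_self, Fin.le_def]; omega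
    · rw [Function.update_of_ne (fun hc => hl (h1 hc))]; exact h2 l

/-- add `t` times row `a'` to row `a`. -/
def rowop {n : ℕ} (M : Matrix (Fin n) (Fin n) ℝ) (a a' : Fin n) (t : ℝ) :
    Matrix (Fin n) (Fin n) ℝ := Matrix.of fun i j => M i j + if i = a then t * M a' j else 0

theorem aux_rowop1 {k n : ℕ} (M : Matrix (Fin n) (Fin n) ℝ) (a' : Fin n) (t : ℝ)
    (f c : Fin k → Fin n) (hf : Function.Injective f) (i0 : Fin k) :
    det ((rowop M (f i0) a' t).submatrix f c) = det (M.submatrix f c) +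
      t * det (M.submatrix (Function.update f i0 a') c) := by
  have e1 : (rowop M (f i0) a' t).submatrix f c =
      (M.submatrix f c).updateRow i0 ((M.submatrix f c).row i0 + t • (fun j => M a' (c j))) := by
    ext i j
    by_cases hi : i = i0
    · subst hi; simp [rowop]
    · simp [rowop, hi, hf.eq_iff]
  have e2 : M.submatrix (Function.update f i0 a') c =
      (M.submatrix f c).updateRow i0 (fun j => M a' (c j)) := by
    ext i j
    by_cases hi : i = i0
    · subst hi; simp
    · simp [hi]
  rw [e1, e2, det_updateRow_add, det_updateRow_smul]
  congr 2
  ext i j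
  by_cases hi : i = i0
  · subst hi; simp
  · simp [hi]

theorem aux_rowop2 {k n : ℕ} (M : Matrix (Fin n) (Fin n) ℝ) (a a' : Fin n) (t : ℝ)
    (f c : Fin k → Fin n) (hf : ∀ i, f i ≠ a) :
    det ((rowop M a a' t).submatrix f c) = det (M.submatrix f c) := by
  congr 1
  ext i j
  simp [rowop, hf]

theorem aux_rowop3 {k n : ℕ} (hk : k ≤ n) (M : Matrix (Fin n) (Fin n) ℝ) (a a' : Fin n)
    (ha : (a' : ℕ) + 1 = a) (t : ℝ) (ht : 0 ≤ t)
    (hM : ∀ f : Fin k → Fin n, StrictMono f → 0 ≤ det (M.submatrix f (rcol hk)))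
    (f : Fin k → Fin n) (hf : StrictMono f) :
    det (M.submatrix f (rcol hk)) ≤ det ((rowop M a a' t).submatrix f (rcol hk)) := by
  by_cases h : ∃ i0, f i0 = a
  · obtain ⟨i0, rfl⟩ := h
    rw [aux_rowop1 M a' t f _ hf.injective i0]
    have : 0 ≤ det (M.submatrix (Function.update f i0 a') (rcol hk)) := by
      by_cases hj : ∃ j, f j = a'
      · obtain ⟨j, hj⟩ := hj
        have hne : j ≠ i0 := by rintro rfl; rw [hj] at ha; omega
        rw [det_zero_of_row_eq hne]
        funext l
        simp [hne, hj]
      · push Not at hj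
        apply hM
        intro x y hxy
        have hxy' := hf hxy
        by_cases hx : x = i0
        · subst hx
          rw [Function.update_self, Function.update_of_ne hxy.ne']
          rw [Fin.lt_def] at hxy' ⊢; omega
        · rw [Function.update_of_ne hx]
          by_cases hy : y = i0
          · subst hy
            rw [Function.update_self]
            have := hj x
            rw [Ne, Fin.ext_iff] at this
            rw [Fin.lt_def] at hxy' ⊢; omega
          · rw [Function.update_of_ne hy]; exact hxy'
    have := mul_nonneg ht this
    linarith
  · push Not at h
    rw [aux_rowop2 M a a' t f _ h]

/-- bad index set. -/
def badS {n : ℕ} (w : Fin n → Fin n) (M : Matrix (Fin n) (Fin n) ℝ) :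
    Finset (Σ k : Fin (n + 1), (Fin k → Fin n)) :=
  univ.filter fun x => StrictMono x.2 ∧ RG w (Nat.lt_succ_iff.1 x.1.2) x.2 ∧
    ¬ 0 < det (M.submatrix x.2 (rcol (Nat.lt_succ_iff.1 x.1.2)))

theorem aux_pert {n : ℕ} (w : Fin n → Fin n) (hw : Function.Injective w) :
    ∀ (N : ℕ) (M : Matrix (Fin n) (Fin n) ℝ), (badS w M).card = N →
    (∀ a b, a < w b → M a b = 0) →
    (∀ (k : ℕ) (hk : k ≤ n) (f : Fin k → Fin n), StrictMono f →
      0 ≤ det (M.submatrix f (rcol hk))) →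
    (∀ (k : ℕ) (hk : k ≤ n) (f : Fin k → Fin n), StrictMono f →
      (∃ σ : Fin k → Fin k, Function.Injective σ ∧ ∀ i, w (rcol hk i) = f (σ i)) →
      0 < det (M.submatrix f (rcol hk))) →
    ∀ U : Set (Matrix (Fin n) (Fin n) ℝ), IsOpen U → M ∈ U → ∃ M' ∈ U,
      (∀ a b, a < w b → M' a b = 0) ∧
      (∀ (k : ℕ) (hk : k ≤ n) (f : Fin k → Fin n), StrictMono f → RG w hk f →
        0 < det (M'.submatrix f (rcol hk))) := by
  intro N
  induction N using Nat.strong_induction_on with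
  | _ N ih =>
    intro M hN h1 hnn hbase U hU hMU
    by_cases hem : badS w M = ∅
    · refine ⟨M, hMU, h1, fun k hk f hf hR => ?_⟩
      by_contra hc
      have : (⟨⟨k, Nat.lt_succ_iff.2 hk⟩, f⟩ : Σ k : Fin (n + 1), (Fin k → Fin n)) ∈ badS w M := by
        simp only [badS, mem_filter, mem_univ, true_and]
        exact ⟨hf, hR, hc⟩
      rw [hem] at this
      simp at this
    · obtain ⟨⟨k, f⟩, hx, hmin⟩ := Finset.exists_min_image (badS w M)
        (fun x => ∑ i, (x.2 i : ℕ)) (Finset.nonempty_iff_ne_empty.2 hem)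
      simp only [badS, mem_filter, mem_univ, true_and] at hx
      obtain ⟨hf, hR, hbad⟩ := hx
      have hk : (k : ℕ) ≤ n := Nat.lt_succ_iff.1 k.2
      obtain ⟨i0, a', ha', hm, hR'⟩ := aux_pred w hw hk f hf hR (fun hc => hbad (hbase _ hk f hf hc))
      have hpos : 0 < det (M.submatrix (Function.update f i0 a') (rcol hk)) := by
        by_contra hc
        have := hmin ⟨k, Function.update f i0 a'⟩ (by
          simp only [badS, mem_filter, mem_univ, true_and]
          exact ⟨hm, hR', hc⟩)
        have hlt : ∑ i, (Function.update f i0 a' i : ℕ) < ∑ i, (f i : ℕ) := by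
          refine Finset.sum_lt_sum (fun i _ => ?_) ⟨i0, mem_univ _, ?_⟩
          · by_cases hi : i = i0
            · subst hi; rw [Function.update_self]; omega
            · rw [Function.update_of_ne hi]
          · rw [Function.update_self]; omega
        simp only at this
        omega
      have hcont : Continuous (fun t : ℝ => rowop M (f i0) a' t) := by
        refine continuous_pi fun i => continuous_pi fun j => ?_
        simp only [rowop, of_apply]
        split_ifs <;> fun_prop
      have h0 : rowop M (f i0) a' 0 = M := by ext i j; simp [rowop]
      have hev : ∀ᶠ t in nhdsWithin (0 : ℝ) (Set.Ioi 0), rowop M (f i0) a' t ∈ U :=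
        nhdsWithin_le_nhds (hcont.continuousAt.eventually_mem (hU.mem_nhds (by rw [h0]; exact hMU)))
      obtain ⟨t, htU, ht⟩ := (hev.and self_mem_nhdsWithin).exists
      replace ht : 0 < t := ht
      have hmono : ∀ (k : ℕ) (hk : k ≤ n) (f2 : Fin k → Fin n), StrictMono f2 →
          det (M.submatrix f2 (rcol hk)) ≤
            det ((rowop M (f i0) a' t).submatrix f2 (rcol hk)) := fun k hk f2 hf2 =>
        aux_rowop3 hk M _ a' ha' t ht.le (hnn k hk) f2 hf2
      refine ih (badS w (rowop M (f i0) a' t)).card ?_ _ rfl ?_ ?_ ?_ U hU htU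
      · rw [← hN]
        refine Finset.card_lt_card ⟨?_, fun hc => ?_⟩
        · intro x hx
          simp only [badS, mem_filter, mem_univ, true_and] at hx ⊢
          exact ⟨hx.1, hx.2.1, fun hc => hx.2.2 (hc.trans_le (hmono _ _ _ hx.1))⟩
        · have := hc (show (⟨k, f⟩ : Σ k : Fin (n + 1), (Fin k → Fin n)) ∈ badS w M by
            simp only [badS, mem_filter, mem_univ, true_and]; exact ⟨hf, hR, hbad⟩)
          simp only [badS, mem_filter, mem_univ, true_and] at this
          apply this.2.2
          rw [aux_rowop1 M a' t f _ hf.injective i0]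
          have h5 := hnn _ hk f hf
          have h6 := mul_pos ht hpos
          linarith
      · intro a b hab
        simp only [rowop, of_apply]
        rw [h1 a b hab]
        split_ifs with hc
        · rw [h1 a' b, mul_zero, add_zero]
          refine lt_trans ?_ hab
          rw [hc, Fin.lt_def]; omega
        · simp
      · intro k hk f2 hf2
        exact (hnn k hk f2 hf2).trans (hmono k hk f2 hf2)
      · intro k hk f2 hf2 hσ
        exact (hbase k hk f2 hf2 hσ).trans_le (hmono k hk f2 hf2)

/-- auxiliary matrix for the renormalisation. -/
def Qb {n : ℕ} (w : Fin n → Fin n) (M : Matrix (Fin n) (Fin n) ℝ) (b : Fin n) :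
    Matrix (Fin n) (Fin n) ℝ :=
  Matrix.of fun i j => if i ≤ b then (if i = j then 1 else 0) else M (w i) j

def Bm {n : ℕ} (w : Fin n → Fin n) (M : Matrix (Fin n) (Fin n) ℝ) : Matrix (Fin n) (Fin n) ℝ :=
  Matrix.of fun j b => (Qb w M b)⁻¹ j b

theorem aux_Bm1 {n : ℕ} (w : Fin n → Fin n) (M : Matrix (Fin n) (Fin n) ℝ)
    (hd : ∀ b, (Qb w M b).det ≠ 0) :
    (∀ b, Bm w M b b = 1) ∧ (∀ j b, j < b → Bm w M j b = 0) ∧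
      (∀ i b, b < i → (M * Bm w M) (w i) b = 0) := by
  have key : ∀ b i, ∑ j, Qb w M b i j * Bm w M j b = if i = b then 1 else 0 := by
    intro b i
    have := mul_nonsing_inv (Qb w M b) (isUnit_iff_ne_zero.2 (hd b))
    have := congrFun (congrFun this i) b
    rw [mul_apply, one_apply] at this
    exact this
  have key2 : ∀ b i, i ≤ b → Bm w M i b = if i = b then 1 else 0 := by
    intro b i hi
    rw [← key b i, Finset.sum_eq_single i]
    · simp [Qb, hi]
    · intro j _ hj
      simp [Qb, hi, hj.symm]
    · simp
  refine ⟨fun b => by rw [key2 b b le_rfl]; simp, fun j b hj => by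
    rw [key2 b j hj.le]; simp [hj.ne], fun i b hb => ?_⟩
  have := key b i
  rw [if_neg hb.ne'] at this
  rw [← this, mul_apply]
  refine Finset.sum_congr rfl fun j _ => ?_
  simp [Qb, hb]

theorem aux_Bm2 {n : ℕ} (w : Fin n → Fin n) (M : Matrix (Fin n) (Fin n) ℝ)
    (hd : ∀ b, (Qb w M b).det ≠ 0) (h1 : ∀ a b, a < w b → M a b = 0) :
    ∀ a b, a < w b → (M * Bm w M) a b = 0 := by
  have hB : ∀ j b, w j < w b → Bm w M j b = 0 := by
    intro j b hjb
    have bt : BlockTriangular (Qb w M b) (fun i => OrderDual.toDual (w i)) := by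
      intro i l hil
      have hil' : w i < w l := hil
      simp only [Qb, of_apply]
      split_ifs with h3 h4
      · subst h4; exact absurd hil' (lt_irrefl _)
      · rfl
      · exact h1 _ _ hil'
    have : Invertible (Qb w M b) := invertibleOfIsUnitDet _ (isUnit_iff_ne_zero.2 (hd b))
    exact blockTriangular_inv_of_blockTriangular bt hjb
  intro a b hab
  rw [mul_apply]
  refine Finset.sum_eq_zero fun j _ => ?_
  by_cases hj : a < w j
  · rw [h1 _ _ hj, zero_mul]
  · rw [hB j b (lt_of_le_of_lt (not_lt.1 hj) hab), mul_zero]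

theorem aux_rcol_inj {k n : ℕ} (hk : k ≤ n) : Function.Injective (rcol hk) := by
  intro i j hij
  have := congrArg Fin.val hij
  ext
  simpa [rcol] using this

theorem aux_rcol_lt {k n : ℕ} (hk : k ≤ n) {i j : Fin k} : rcol hk i < rcol hk j ↔ i < j := by
  simp only [rcol, Fin.lt_def]; omega

theorem aux_Bdet {k n : ℕ} (hk : k ≤ n) (M B : Matrix (Fin n) (Fin n) ℝ)
    (hB1 : ∀ b, B b b = 1) (hB2 : ∀ j b, j < b → B j b = 0) (f : Fin k → Fin n) :
    det ((M * B).submatrix f (rcol hk)) = det (M.submatrix f (rcol hk)) := by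
  have e : (M * B).submatrix f (rcol hk) =
      M.submatrix f (rcol hk) * B.submatrix (rcol hk) (rcol hk) := by
    ext i j
    simp only [submatrix_apply, mul_apply]
    symm
    refine Fintype.sum_of_injective (rcol hk) (aux_rcol_inj hk) _ _ ?_ (fun _ => rfl)
    intro l hl
    rw [hB2 l, mul_zero]
    by_contra hc
    apply hl
    have hc' : (rcol hk j : ℕ) ≤ l := not_lt.1 hc
    simp only [rcol] at hc'
    refine ⟨⟨l - (n - k), by omega⟩, ?_⟩
    ext
    simp only [rcol]
    omega
  have e2 : det (B.submatrix (rcol hk) (rcol hk)) = 1 := by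
    have bt : BlockTriangular (B.submatrix (rcol hk) (rcol hk)) OrderDual.toDual :=
      fun i j hij => hB2 _ _ ((aux_rcol_lt hk).2 (OrderDual.toDual_lt_toDual.1 hij))
    rw [det_of_isLowerTriangular _ bt]
    simp [hB1]
  rw [e, det_mul, e2, mul_one]

theorem aux_diag {n : ℕ} (w : Fin n → Fin n) (hw : Function.Bijective w)
    (h : Matrix (Fin n) (Fin n) ℝ) (hd : det h ≠ 0) (h2 : ∀ b b', b < b' → h (w b') b = 0) :
    ∀ i, h (w i) i ≠ 0 := by
  have e : det (h.submatrix w id) ≠ 0 := by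
    have := det_permute (Equiv.ofBijective w hw) h
    change det (h.submatrix w id) = _ at this
    rw [this]
    refine mul_ne_zero ?_ hd
    rcases Int.units_eq_one_or (Equiv.Perm.sign (Equiv.ofBijective w hw)) with h | h <;> simp [h]
  have bt : BlockTriangular (h.submatrix w id) id := fun i j hij => h2 _ _ hij
  rw [det_of_isUpperTriangular bt] at e
  intro i
  exact Finset.prod_ne_zero_iff.1 e i (mem_univ i)

theorem aux_Qbh {n : ℕ} (w : Fin n → Fin n) (hw : Function.Bijective w)
    (h : Matrix (Fin n) (Fin n) ℝ) (hd : det h ≠ 0) (h2 : ∀ b b', b < b' → h (w b') b = 0) :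
    (∀ b, (Qb w h b).det ≠ 0) ∧ Bm w h = 1 := by
  have bt : ∀ b, BlockTriangular (Qb w h b) id := by
    intro b i j hij
    have hij' : j < i := hij
    simp only [Qb, of_apply]
    split_ifs with h3 h4
    · exact absurd h4 hij'.ne'
    · rfl
    · exact h2 _ _ hij'
  have hdet : ∀ b, (Qb w h b).det ≠ 0 := by
    intro b
    rw [det_of_isUpperTriangular (bt b)]
    refine Finset.prod_ne_zero_iff.2 fun i _ => ?_
    simp only [Qb, of_apply]
    split_ifs
    · exact one_ne_zero
    · exact aux_diag w hw h hd h2 i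
  refine ⟨hdet, ?_⟩
  obtain ⟨c1, c2, -⟩ := aux_Bm1 w h hdet
  ext j b
  rcases lt_trichotomy j b with hl | hl | hl
  · rw [c2 _ _ hl, one_apply_ne hl.ne]
  · subst hl; rw [c1, one_apply_eq]
  · have : Invertible (Qb w h b) := invertibleOfIsUnitDet _ (isUnit_iff_ne_zero.2 (hdet b))
    rw [one_apply_ne hl.ne']
    exact blockTriangular_inv_of_blockTriangular (bt b) hl

theorem aux_cinv {X : Type*} [TopologicalSpace X] {n : ℕ} (F : X → Matrix (Fin n) (Fin n) ℝ)
    (x : X) (hF : ContinuousAt F x) (hd : (F x).det ≠ 0) :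
    ContinuousAt (fun y => (F y)⁻¹) x := by
  simp only [Matrix.inv_def, Ring.inverse_eq_inv']
  have h1 : ContinuousAt (fun y => (F y).det) x :=
    (Continuous.matrix_det continuous_id).continuousAt.comp hF
  have h2 : ContinuousAt (fun y => (F y).adjugate) x :=
    (Continuous.matrix_adjugate continuous_id).continuousAt.comp hF
  exact (h1.inv₀ hd).smul h2

theorem aux_base {k n : ℕ} (hk : k ≤ n) (w : Fin n → Fin n) (hw : Function.Bijective w)
    (h : Matrix (Fin n) (Fin n) ℝ) (hd : det h ≠ 0) (h2 : ∀ b b', b < b' → h (w b') b = 0)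
    (f : Fin k → Fin n) (σ : Fin k → Fin k) (hσ : Function.Injective σ)
    (hf : ∀ i, w (rcol hk i) = f (σ i)) : det (h.submatrix f (rcol hk)) ≠ 0 := by
  have hσb : Function.Bijective σ := Finite.injective_iff_bijective.1 hσ
  have e := det_permute (Equiv.ofBijective σ hσb) (h.submatrix f (rcol hk))
  have e2 : (h.submatrix f (rcol hk)).submatrix (Equiv.ofBijective σ hσb) id =
      Matrix.of fun i j => h (w (rcol hk i)) (rcol hk j) := by
    ext i j
    simp only [submatrix_apply, of_apply, hf]
    rfl
  have bt : BlockTriangular (Matrix.of fun i j => h (w (rcol hk i)) (rcol hk j)) id :=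
    fun i j hij => h2 _ _ ((aux_rcol_lt hk).2 hij)
  rw [e2, det_of_isUpperTriangular bt] at e
  intro hc
  rw [hc, mul_zero] at e
  exact Finset.prod_ne_zero_iff.2 (fun i _ => aux_diag w hw h hd h2 (rcol hk i)) e

theorem aux_main {n : ℕ} (w : Fin n → Fin n) (hw : Function.Bijective w)
    (h g : Matrix (Fin n) (Fin n) ℝ) (hg : g * hᵀ = 1)
    (h1 : ∀ a b, a < w b → h a b = 0) (h2 : ∀ b b', b < b' → h (w b') b = 0)
    (hnn : ∀ (k : ℕ) (hk : k ≤ n) (f : Fin k → Fin n), StrictMono f →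
      0 ≤ det (h.submatrix f (rcol hk))) :
    ∀ (m : ℕ) (hm : m ≤ n) (κ : Fin m → Fin n), StrictMono κ →
      0 ≤ det (g.submatrix (Fin.castLE hm) κ) := by
  have hdT : (hᵀ).det ≠ 0 := by
    intro hc
    have := congrArg det hg
    rw [det_mul, hc, mul_zero, det_one] at this
    exact zero_ne_one this
  have hd : h.det ≠ 0 := by rwa [det_transpose] at hdT
  have hginv : g = (hᵀ)⁻¹ := (inv_eq_left_inv hg).symm
  obtain ⟨hQ, hB⟩ := aux_Qbh w hw h hd h2
  intro m hm κ hκ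
  by_contra hneg
  push Not at hneg
  let F : Matrix (Fin n) (Fin n) ℝ → Matrix (Fin n) (Fin n) ℝ := fun M => M * Bm w M
  have hFh : F h = h := by simp only [F]; rw [hB, mul_one]
  have hQc : ∀ b, Continuous (fun M => Qb w M b) := by
    intro b
    refine continuous_pi fun i => continuous_pi fun j => ?_
    simp only [Qb, of_apply]
    split_ifs
    · exact continuous_const
    · exact continuous_const
    · exact continuous_apply_apply (w i) j
  have hBc : ContinuousAt (fun M => Bm w M) h := by
    refine continuousAt_pi.2 fun j => continuousAt_pi.2 fun b => ?_
    have := aux_cinv (fun M => Qb w M b) h (hQc b).continuousAt (hQ b)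
    exact continuousAt_pi.1 (continuousAt_pi.1 this j) b
  have hFc : ContinuousAt F h := continuousAt_id.mul hBc
  have hFTc : ContinuousAt (fun M => (F M)ᵀ) h :=
    (Continuous.matrix_transpose continuous_id).continuousAt.comp hFc
  have hGc : ContinuousAt (fun M => ((F M)ᵀ)⁻¹) h := aux_cinv _ h hFTc (by rw [hFh]; exact hdT)
  have hTc : ContinuousAt (fun M => det ((((F M)ᵀ)⁻¹).submatrix (Fin.castLE hm) κ)) h :=
    (Continuous.matrix_det (Continuous.matrix_submatrix continuous_id _ _)).continuousAt.comp hGc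
  have hdc : ContinuousAt (fun M => ((F M)ᵀ).det) h :=
    (Continuous.matrix_det continuous_id).continuousAt.comp hFTc
  have ev1 : ∀ᶠ M in nhds h, det ((((F M)ᵀ)⁻¹).submatrix (Fin.castLE hm) κ) < 0 :=
    hTc.eventually_lt continuousAt_const (by rw [hFh, ← hginv]; exact hneg)
  have ev2 : ∀ᶠ M in nhds h, ((F M)ᵀ).det ≠ 0 := hdc.eventually_ne (by rw [hFh]; exact hdT)
  have ev3 : ∀ᶠ M in nhds h, ∀ b, (Qb w M b).det ≠ 0 := by
    rw [Filter.eventually_all]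
    intro b
    exact ((Continuous.matrix_det (hQc b)).continuousAt).eventually_ne (hQ b)
  obtain ⟨U, hU, hUo, hhU⟩ := eventually_nhds_iff.1 (ev1.and (ev2.and ev3))
  obtain ⟨M, hMU, hM1, hMg⟩ := aux_pert w hw.1 _ h rfl h1 hnn (by
    rintro k hk f hf ⟨σ, hσ, hfσ⟩
    exact lt_of_le_of_ne (hnn k hk f hf) (aux_base hk w hw h hd h2 f σ hσ hfσ).symm) U hUo hhU
  obtain ⟨m1, m2, m3⟩ := hU M hMU
  obtain ⟨b1, b2, b3⟩ := aux_Bm1 w M m3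
  have hinv : ((F M)ᵀ)⁻¹ * (F M)ᵀ = 1 := nonsing_inv_mul _ (isUnit_iff_ne_zero.2 m2)
  have hsupp : ∀ b b', b < b' → F M (w b') b = 0 := fun b b' hb => b3 b' b hb
  by_cases hT : TG w κ
  · have := aux_P n w hw (F M) _ hinv hsupp (by
      intro k hk f hf hR
      simp only [F]
      rw [aux_Bdet hk M _ b1 b2 f]
      exact hMg k hk f hf hR) m hm κ hκ hT
    linarith
  · have := aux_Tzero hm w hw _ (aux_gsupp2 w hw _ _ hinv hsupp) κ hT
    linarith

theorem aux_revmain {n : ℕ} (w : Fin n → Fin n) (hw : Function.Bijective w)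
    (h g : Matrix (Fin n) (Fin n) ℝ) (hg : g * hᵀ = 1)
    (h1 : ∀ a b, a < w b → h a b = 0) (h2 : ∀ b b', b < b' → h (w b') b = 0)
    (hT : ∀ (m : ℕ) (hm : m ≤ n) (κ : Fin m → Fin n), StrictMono κ →
      0 ≤ det (g.submatrix (Fin.castLE hm) κ)) :
    ∀ (k : ℕ) (hk : k ≤ n) (f : Fin k → Fin n), StrictMono f →
      0 ≤ det (h.submatrix f (rcol hk)) := by
  have gs1 := aux_gsupp1 w hw h g hg h1
  have gs2 := aux_gsupp2 w hw h g hg h2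
  let e := Equiv.ofBijective w hw
  have he : ∀ x, w (e.symm x) = x := fun x => e.apply_symm_apply x
  let w2 : Fin n → Fin n := fun a => Fin.rev (e.symm (Fin.rev a))
  have hw2 : Function.Bijective w2 :=
    Fin.rev_bijective.comp (e.symm.bijective.comp Fin.rev_bijective)
  have hr1 : ∀ (k : ℕ) (hk : k ≤ n) (i : Fin k), Fin.rev (rcol hk i) = Fin.castLE hk (Fin.rev i) := by
    intro k hk i
    ext
    simp only [rcol, Fin.val_rev, Fin.val_castLE]
    omega
  have hr2 : ∀ (k : ℕ) (hk : k ≤ n) (i : Fin k), Fin.rev (Fin.castLE hk i) = rcol hk (Fin.rev i) := by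
    intro k hk i
    rw [Fin.rev_eq_iff, hr1, Fin.rev_rev]
  have hmono : ∀ (k : ℕ) (f : Fin k → Fin n), StrictMono f →
      StrictMono (fun i => Fin.rev (f (Fin.rev i))) := by
    intro k f hf i j hij
    exact Fin.rev_lt_rev.2 (hf (Fin.rev_lt_rev.2 hij))
  have key := aux_main w2 hw2 (Matrix.of fun a b => g (Fin.rev b) (Fin.rev a))
    (Matrix.of fun a b => h (Fin.rev b) (Fin.rev a)) (by
      have hg' : hᵀ * g = 1 := mul_eq_one_comm.1 hg
      ext a a'
      have := congrFun (congrFun hg' (Fin.rev a)) (Fin.rev a')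
      rw [mul_apply] at this ⊢
      rw [← Equiv.sum_comp Fin.revPerm] at this
      simp only [transpose_apply, of_apply, Fin.revPerm_apply] at this ⊢
      rw [this]
      simp [one_apply]) (by
      intro a b hab
      simp only [of_apply]
      have := gs2 (e.symm (Fin.rev b)) (Fin.rev a) (by
        rw [← Fin.rev_lt_rev, Fin.rev_rev]; exact hab)
      rwa [he] at this) (by
      intro b b' hb
      simp only [of_apply, w2, Fin.rev_rev]
      apply gs1
      rw [he]
      exact Fin.rev_lt_rev.2 hb) (by
      intro k hk f hf
      have := hT k hk _ (hmono k f hf)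
      rw [← det_transpose, ← det_submatrix_equiv_self Fin.revPerm] at this
      convert this using 2
      ext i j
      simp [hr1])
  intro k hk f hf
  have := key k hk _ (hmono k f hf)
  rw [← det_transpose, ← det_submatrix_equiv_self Fin.revPerm] at this
  convert this using 2
  ext i j
  simp [hr2]

theorem aux_minor {n k : ℕ} (g : Matrix (Fin n) (Fin n) ℝ) (I J : Finset (Fin n))
    (hI : I.card = k) (hJ : J.card = k) (f c : Fin k → Fin n) (hf : StrictMono f)
    (hc : StrictMono c) (hfI : ∀ i, f i ∈ I) (hcJ : ∀ i, c i ∈ J) :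
    minor g I J = det (g.submatrix f c) := by
  subst hI
  rw [minor, dif_pos hJ.symm, Finset.orderEmbOfFin_unique rfl hfI hf,
    Finset.orderEmbOfFin_unique hJ hcJ hc]
  rfl

theorem aux_cardR {n k : ℕ} (hk : k ≤ n) :
    (univ.filter fun j : Fin n => n - k ≤ (j : ℕ)).card = k := by
  have : (univ.filter fun j : Fin n => n - k ≤ (j : ℕ)) = univ.image (rcol hk) := by
    ext j
    simp only [mem_filter, mem_univ, true_and, mem_image]
    constructor
    · intro h
      refine ⟨⟨j - (n - k), by omega⟩, ?_⟩
      ext; simp only [rcol]; omega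
    · rintro ⟨i, rfl⟩; simp only [rcol]; omega
  rw [this, Finset.card_image_of_injective _ (aux_rcol_inj hk)]
  simp

theorem aux_cardT {n k : ℕ} (hk : k ≤ n) :
    (univ.filter fun j : Fin n => (j : ℕ) < k).card = k := by
  have : (univ.filter fun j : Fin n => (j : ℕ) < k) = univ.image (Fin.castLE hk) := by
    ext j
    simp only [mem_filter, mem_univ, true_and, mem_image]
    constructor
    · intro h
      exact ⟨⟨j, h⟩, by ext; simp⟩
    · rintro ⟨i, rfl⟩; simp
  rw [this, Finset.card_image_of_injective _ (Fin.castLE_injective hk)]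
  simp

theorem aux_card_le {n : ℕ} (I : Finset (Fin n)) : I.card ≤ n := by
  simpa using Finset.card_le_univ I

theorem aux_right_iff {n : ℕ} (h : Matrix (Fin n) (Fin n) ℝ) : RightFlagNonneg h ↔
    ∀ (k : ℕ) (hk : k ≤ n) (f : Fin k → Fin n), StrictMono f →
      0 ≤ det (h.submatrix f (rcol hk)) := by
  have hrm : ∀ (k : ℕ) (hk : k ≤ n), StrictMono (rcol hk) := fun k hk i j hij =>
    (aux_rcol_lt hk).2 hij
  have hmem : ∀ (k : ℕ) (hk : k ≤ n) (i : Fin k),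
      rcol hk i ∈ univ.filter fun j : Fin n => n - k ≤ (j : ℕ) := by
    intro k hk i; simp only [mem_filter, mem_univ, true_and, rcol]; omega
  constructor
  · intro H k hk f hf
    have hc : (univ.image f).card = k := by
      rw [Finset.card_image_of_injective _ hf.injective]; simp
    have := H (univ.image f)
    rw [hc, aux_minor h _ _ hc (aux_cardR hk) f (rcol hk) hf (hrm k hk) (by simp)
      (hmem k hk)] at this
    exact this
  · intro H I
    have hk := aux_card_le I
    rw [aux_minor h _ _ rfl (aux_cardR hk) (I.orderEmbOfFin rfl) (rcol hk)
      (I.orderEmbOfFin rfl).strictMono (hrm _ hk) (fun i => Finset.orderEmbOfFin_mem _ _ _)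
      (hmem _ hk)]
    exact H _ hk _ (I.orderEmbOfFin rfl).strictMono

theorem aux_top_iff {n : ℕ} (g : Matrix (Fin n) (Fin n) ℝ) : TopFlagNonneg g ↔
    ∀ (m : ℕ) (hm : m ≤ n) (κ : Fin m → Fin n), StrictMono κ →
      0 ≤ det (g.submatrix (Fin.castLE hm) κ) := by
  have hmem : ∀ (k : ℕ) (hk : k ≤ n) (i : Fin k),
      Fin.castLE hk i ∈ univ.filter fun j : Fin n => (j : ℕ) < k := by
    intro k hk i; simp
  constructor
  · intro H k hk f hf
    have hc : (univ.image f).card = k := by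
      rw [Finset.card_image_of_injective _ hf.injective]; simp
    have := H (univ.image f)
    rw [hc, aux_minor g _ _ (aux_cardT hk) hc (Fin.castLE hk) f (Fin.strictMono_castLE hk) hf
      (hmem k hk) (by simp)] at this
    exact this
  · intro H J
    have hk := aux_card_le J
    rw [aux_minor g _ _ (aux_cardT hk) rfl (Fin.castLE hk) (J.orderEmbOfFin rfl)
      (Fin.strictMono_castLE hk) (J.orderEmbOfFin rfl).strictMono (hmem _ hk)
      (fun i => Finset.orderEmbOfFin_mem _ _ _)]
    exact H _ hk _ (J.orderEmbOfFin rfl).strictMono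

theorem aux_pdot_det {n : ℕ} (w : Equiv.Perm (Fin n)) :
    IsUnit (pdot w : Matrix (Fin n) (Fin n) ℝ).det := by
  have e : (pdot w : Matrix (Fin n) (Fin n) ℝ).submatrix w id = Matrix.diagonal (fun b =>
      (-1 : ℝ) ^ (univ.filter fun k : Fin n => b < k ∧ w k < w b).card) := by
    ext i j
    by_cases hij : i = j
    · subst hij; simp [pdot]
    · simp [pdot, hij]
  have e2 := det_permute w (pdot w : Matrix (Fin n) (Fin n) ℝ)
  rw [e, det_diagonal] at e2
  rw [isUnit_iff_ne_zero]
  intro hc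
  rw [hc, mul_zero] at e2
  exact Finset.prod_ne_zero_iff.2 (fun i _ => pow_ne_zero _ (by norm_num)) e2


/-- the opposite chiral map preserves total positivity (type A). -/
theorem statement_11 {n : ℕ} (hn : 1 ≤ n) (w : Equiv.Perm (Fin n))
    (h : Matrix (Fin n) (Fin n) ℝ) (hdet : h.det = 1)
    (h1 : IsNm (h * (pdot w : Matrix (Fin n) (Fin n) ℝ)⁻¹))
    (h2 : IsN ((pdot w : Matrix (Fin n) (Fin n) ℝ)⁻¹ * h)) :
    RightFlagNonneg h ↔ TopFlagNonneg (hᵀ)⁻¹ := by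
  have hu := aux_pdot_det w
  have e1 : h = (h * (pdot w : Matrix (Fin n) (Fin n) ℝ)⁻¹) * pdot w := by
    rw [mul_assoc, nonsing_inv_mul _ hu, mul_one]
  have e2 : h = pdot w * ((pdot w : Matrix (Fin n) (Fin n) ℝ)⁻¹ * h) := by
    rw [← mul_assoc, mul_nonsing_inv _ hu, one_mul]
  have s1 : ∀ a b, a < w b → h a b = 0 := by
    intro a b hab
    rw [e1, mul_apply]
    refine Finset.sum_eq_zero fun c _ => ?_
    by_cases hc : c = w b
    · subst hc; rw [h1.2 _ _ hab, zero_mul]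
    · simp [pdot, hc]
  have s2 : ∀ b b', b < b' → h (w b') b = 0 := by
    intro b b' hb
    rw [e2, mul_apply]
    refine Finset.sum_eq_zero fun c _ => ?_
    by_cases hc : c = b'
    · subst hc; rw [h2.2 _ _ hb, mul_zero]
    · have : ¬ w b' = w c := fun h => hc (w.injective h).symm
      simp [pdot, this]
  have hg : (hᵀ)⁻¹ * hᵀ = 1 := nonsing_inv_mul _ (by rw [det_transpose, hdet]; exact isUnit_one)
  rw [aux_right_iff, aux_top_iff]
  exact ⟨aux_main w w.bijective h _ hg s1 s2, aux_revmain w w.bijective h _ hg s1 s2⟩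

end
end Paper
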